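/- Let n be a positive integer and let p be a divisor of 2n−1. The number of permutations in M_{2n} whose difference sequence is periodic with a period dividing p equals 2·(p!/(p+1)) · ((2n−1)/p)^p · ψ((2n−1)/p), where ψ(m) denotes the number of integers c with 1 ≤ c ≤ m and gcd(c, m) = gcd(c−1, m) = 1. -/

import Mathlib

/-- The representative of `x : ZMod n` in `{1, …, n}` (so `0` represents `n`). -/
def repr1 (n : ℕ) (x : ZMod n) : ℕ := if x = 0 then n else x.val

/-- Values of `ZMod n`, embedded into `ZMod (n+1)` via representatives in `{1, …, n}`. -/
def emb (n : ℕ) (x : ZMod n) : ZMod (n + 1) := (repr1 n x : ZMod (n + 1))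

/-- `L 0 = 0` and `L i = π(i)` for `i ∈ {1,…,n}`: the listing used to build
the cycle `Y_π = (π(n) π(n−1) … π(1) 0)`. -/
def listFun (n : ℕ) (π : Equiv.Perm (ZMod n)) : ZMod (n + 1) → ZMod (n + 1) :=
  fun i => if i = 0 then 0 else emb n (π (i.val : ZMod n))

/-- The inverse listing of `listFun`. -/
def listInv (n : ℕ) (π : Equiv.Perm (ZMod n)) : ZMod (n + 1) → ZMod (n + 1) :=
  fun y => if y = 0 then 0 else emb n (π.symm (y.val : ZMod n))

/-- The cycle `Y_π = (π(n) π(n−1) … π(1) 0)` on `{0,1,…,n}`, as a function: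
it sends `L(i)` to `L(i-1)`. -/
def Yfun (n : ℕ) (π : Equiv.Perm (ZMod n)) : ZMod (n + 1) → ZMod (n + 1) :=
  fun y => listFun n π (listInv n π y - 1)

/-- `C_π = Y_π ∘ X_n`, where `X_n` is the cycle `(0 1 2 … n)`, i.e. `x ↦ x + 1`. -/
def Cfun (n : ℕ) (π : Equiv.Perm (ZMod n)) : ZMod (n + 1) → ZMod (n + 1) :=
  fun x => Yfun n π (x + 1)

/-- The strategic pile of `π ∈ S_n`: the set of values appearing strictly after `n` and
strictly before `0` on the cycle of `C_π` containing `0` and `n` (empty if `0` and `n`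
lie in different cycles). -/
def strategicPile (n : ℕ) (π : Equiv.Perm (ZMod n)) : Set (ZMod (n + 1)) :=
  {x | ∃ k m : ℕ, 0 < k ∧ k < m ∧ (Cfun n π)^[m] (n : ZMod (n + 1)) = 0 ∧
      (∀ j, 0 < j → j < m → (Cfun n π)^[j] (n : ZMod (n + 1)) ≠ 0) ∧
      (Cfun n π)^[k] (n : ZMod (n + 1)) = x}

/-- `π ∈ S_n` has maximal strategic pile. -/
def MaxPile (n : ℕ) (π : Equiv.Perm (ZMod n)) : Prop :=
  (Even n ∧ (strategicPile n π).ncard = n - 1) ∨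
  (Odd n ∧ (strategicPile n π).ncard = n - 2)

/-- The position (in `{1,…,n}`) of the value `v` in `π`. -/
def idx (n : ℕ) (π : Equiv.Perm (ZMod n)) (v : ZMod n) : ℕ := repr1 n (π.symm v)

/-- Word coordinate of the occurrence of the pointer `(p,p+1)` as the right pointer of the
entry `p`:  the entry at position `i` is given word coordinate `3*i - 1`, its left pointer
coordinate `3*i - 2` and its right pointer coordinate `3*i`. -/
def posR (n : ℕ) (π : Equiv.Perm (ZMod n)) (p : ZMod n) : ℕ := 3 * idx n π p

/-- Word coordinate of the occurrence of the pointer `(p,p+1)` as the left pointer of the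
entry `p+1`. -/
def posL (n : ℕ) (π : Equiv.Perm (ZMod n)) (p : ZMod n) : ℕ := 3 * idx n π (p + 1) - 2

/-- Two pairs of positions interleave (pattern `a b a b` or `b a b a`). -/
def Interleaved (a1 a2 b1 b2 : ℕ) : Prop :=
  (min a1 a2 < min b1 b2 ∧ min b1 b2 < max a1 a2 ∧ max a1 a2 < max b1 b2) ∨
  (min b1 b2 < min a1 a2 ∧ min a1 a2 < max b1 b2 ∧ max b1 b2 < max a1 a2)

/-- `(p, q)` is a valid pointer context for `π`: the two pointers are distinct and their
occurrences in the pointer word of `π` appear in the order `p,q,p,q` or `q,p,q,p`. -/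
def ValidContext (n : ℕ) (π : Equiv.Perm (ZMod n)) (p q : ZMod n) : Prop :=
  p ≠ q ∧ Interleaved (posR n π p) (posL n π p) (posR n π q) (posL n π q)

/-- The number of (unordered) valid pointer contexts of `π`. -/
noncomputable def numContexts (n : ℕ) (π : Equiv.Perm (ZMod n)) : ℕ :=
  {pq : ZMod n × ZMod n | ValidContext n π pq.1 pq.2}.ncard / 2

/-- `ρ ∈ S_{2n−1}` is the contraction of `π ∈ S_{2n}`, obtained by deleting the entry `2n`. -/
def IsContraction (n : ℕ) (ρ : Equiv.Perm (ZMod (2 * n - 1)))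
    (π : Equiv.Perm (ZMod (2 * n))) : Prop :=
  ∃ m : ℕ, 1 ≤ m ∧ m ≤ 2 * n ∧ π (m : ZMod (2 * n)) = ((2 * n : ℕ) : ZMod (2 * n)) ∧
    (∀ k : ℕ, 1 ≤ k → k < m →
      ρ (k : ZMod (2 * n - 1)) =
        ((repr1 (2 * n) (π (k : ZMod (2 * n))) : ℕ) : ZMod (2 * n - 1))) ∧
    (∀ k : ℕ, m ≤ k → k ≤ 2 * n - 1 →
      ρ (k : ZMod (2 * n - 1)) =
        ((repr1 (2 * n) (π ((k + 1 : ℕ) : ZMod (2 * n))) : ℕ) : ZMod (2 * n - 1)))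

/-- `M_{2n}`: the contractions of permutations in `S_{2n}` with maximal strategic pile. -/
def MsetAll (n : ℕ) : Set (Equiv.Perm (ZMod (2 * n - 1))) :=
  {ρ | ∃ π : Equiv.Perm (ZMod (2 * n)), MaxPile (2 * n) π ∧ IsContraction n ρ π}

/-- `M_{2n,k}`: the contractions of permutations in `S_{2n}` with maximal strategic pile
and exactly `k` valid pointer contexts. -/
def Mset (n k : ℕ) : Set (Equiv.Perm (ZMod (2 * n - 1))) :=
  {ρ | ρ ∈ MsetAll n ∧ numContexts (2 * n - 1) ρ = k}

/-- Cyclic shift by `a`: `C_a(π)(x) = π(x - a)`. -/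
def Cshift (n : ℕ) (a : ZMod n) (π : Equiv.Perm (ZMod n)) : Equiv.Perm (ZMod n) :=
  (Equiv.subRight a).trans π

/-- Translation by `b`: `T_b(π)(x) = π(x) + b`. -/
def Tshift (n : ℕ) (b : ZMod n) (π : Equiv.Perm (ZMod n)) : Equiv.Perm (ZMod n) :=
  π.trans (Equiv.addRight b)

/-- `φ(a,b,π) = C_a(T_b(π))`, i.e. `x ↦ π(x-a) + b`. -/
def phiAct (n : ℕ) (a b : ZMod n) (π : Equiv.Perm (ZMod n)) : Equiv.Perm (ZMod n) :=
  Cshift n a (Tshift n b π)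

/-- The difference sequence of `π`. -/
def Dseq (n : ℕ) (π : Equiv.Perm (ZMod n)) : ZMod n → ZMod n :=
  fun k => π (k + 1) - π k

/-- The difference sequence of `π` is periodic with (least) period `p`, `0 < p < n`. -/
def PeriodicWith (n : ℕ) (π : Equiv.Perm (ZMod n)) (p : ℕ) : Prop :=
  0 < p ∧ p < n ∧ (∀ k : ZMod n, Dseq n π (k + (p : ZMod n)) = Dseq n π k) ∧
    ∀ q : ℕ, 0 < q → q < p → ¬ ∀ k : ZMod n, Dseq n π (k + (q : ZMod n)) = Dseq n π k

/-- The variant `ψ` of Euler's totient function: the number of `c` with `1 ≤ c ≤ m` and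
`gcd(c,m) = gcd(c-1,m) = 1`. -/
def psi (m : ℕ) : ℕ :=
  ((Finset.Icc 1 m).filter fun c => Nat.gcd c m = 1 ∧ Nat.gcd (c - 1) m = 1).card

section
open Equiv

/-- The permutations supported in `s` that act on `s` as a single cycle. -/
def cyclesOn {α : Type*} [DecidableEq α] [Fintype α] (s : Finset α) : Finset (Perm α) :=
  {σ | (∀ x ∉ s, σ x = x) ∧ ∀ T ⊆ s, T.Nonempty → (∀ x ∈ T, σ x ∈ T) → T = s}

/-- The permutations supported in `s` of sign `u`. -/
def permsOn {α : Type*} [DecidableEq α] [Fintype α] (u : ℤˣ) (s : Finset α) :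
    Finset (Perm α) :=
  {σ | (∀ x ∉ s, σ x = x) ∧ Perm.sign σ = u}

theorem apply_mem_iff_of_fixes {α : Type*} {s : Finset α} {σ : Perm α}
    (h : ∀ x ∉ s, σ x = x) (x : α) :
    σ x ∈ s ↔ x ∈ s := by
  constructor
  · intro hx
    by_contra hxs
    exact hxs (h x hxs ▸ hx)
  · intro hx
    by_contra hxs
    have := σ.injective (h _ hxs)
    exact hxs (this.symm ▸ hx)

theorem commute_swap_of_fixes {α : Type*} [DecidableEq α] {σ : Perm α} {x y : α}
    (hx : σ x = x) (hy : σ y = y) :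
    σ * swap x y = swap x y * σ := by
  rw [mul_swap_eq_swap_mul, hx, hy]

section Cycles

variable {α : Type*} [DecidableEq α] [Fintype α]

theorem mem_cyclesOn {s : Finset α} {σ : Perm α} : σ ∈ cyclesOn s ↔
    (∀ x ∉ s, σ x = x) ∧ ∀ T ⊆ s, T.Nonempty → (∀ x ∈ T, σ x ∈ T) → T = s := by
  simp [cyclesOn]

theorem mem_permsOn {u : ℤˣ} {s : Finset α} {σ : Perm α} : σ ∈ permsOn u s ↔
    (∀ x ∉ s, σ x = x) ∧ Perm.sign σ = u := by
  simp [permsOn]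

theorem inv_mem_cyclesOn {s : Finset α} {σ : Perm α} (h : σ ∈ cyclesOn s) :
    σ⁻¹ ∈ cyclesOn s := by
  rw [mem_cyclesOn] at h ⊢
  refine ⟨fun x hx => by rw [Perm.inv_eq_iff_eq, h.1 x hx], fun T hT hne hcl => h.2 T hT hne ?_⟩
  have himg : T.image (σ⁻¹ : Perm α) = T := by
    apply Finset.eq_of_subset_of_card_le
    · intro y hy
      obtain ⟨x, hx, rfl⟩ := Finset.mem_image.1 hy
      exact hcl x hx
    · rw [Finset.card_image_of_injective _ (σ⁻¹ : Perm α).injective]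
  intro x hx
  rw [← himg] at hx
  obtain ⟨y, hy, rfl⟩ := Finset.mem_image.1 hx
  simpa using hy

theorem swap_mul_mem_cyclesOn {s : Finset α} {f x : α} (hf : f ∉ s) (hx : x ∈ s)
    {γ : Perm α} (hγ : γ ∈ cyclesOn s) : swap f x * γ ∈ cyclesOn (insert f s) := by
  rw [mem_cyclesOn] at hγ ⊢
  obtain ⟨hfix, hcyc⟩ := hγ
  have hff : (swap f x * γ) f = x := by simp [hfix f hf]
  have hxf : x ≠ f := fun h => hf (h ▸ hx)
  refine ⟨fun y hy => ?_, fun T hT hne hcl => ?_⟩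
  · rw [Finset.mem_insert, not_or] at hy
    rw [Perm.mul_apply, hfix y hy.2, swap_apply_of_ne_of_ne hy.1]
    rintro rfl
    exact hy.2 hx
  · have hsub : T.erase f ⊆ s := fun y hy => by
      have := hT (Finset.mem_of_mem_erase hy)
      exact (Finset.mem_insert.1 this).resolve_left (Finset.ne_of_mem_erase hy)
    have hne' : (T.erase f).Nonempty := by
      obtain ⟨y, hy⟩ := hne
      by_cases hyf : y = f
      · subst hyf
        exact ⟨x, Finset.mem_erase.2 ⟨hxf, hff ▸ hcl y hy⟩⟩
      · exact ⟨y, Finset.mem_erase.2 ⟨hyf, hy⟩⟩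
    have hs : T.erase f = s := by
      refine hcyc _ hsub hne' fun y hy => ?_
      have hyT := Finset.mem_of_mem_erase hy
      have hys := hsub hy
      have hγs := (apply_mem_iff_of_fixes hfix y).2 hys
      have hγf : γ y ≠ f := fun h => hf (h ▸ hγs)
      refine Finset.mem_erase.2 ⟨hγf, ?_⟩
      by_cases hyx : γ y = x
      · have h1 := hcl y hyT
        rw [Perm.mul_apply, hyx, swap_apply_right] at h1
        have h2 := hcl f h1
        rwa [hff, ← hyx] at h2
      · have h1 := hcl y hyT
        rwa [Perm.mul_apply, swap_apply_of_ne_of_ne hγf hyx] at h1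
    have hfT : f ∈ T := by
      have : γ⁻¹ x ∈ T.erase f := by
        rw [hs, ← apply_mem_iff_of_fixes hfix]
        simpa using hx
      simpa using hcl _ (Finset.mem_of_mem_erase this)
    rw [← hs, Finset.insert_erase hfT]

theorem swap_mul_mem_cyclesOn_of_insert {s : Finset α} {f : α} (hf : f ∉ s) (hs : s.Nonempty)
    {δ : Perm α} (hδ : δ ∈ cyclesOn (insert f s)) :
    δ f ∈ s ∧ swap f (δ f) * δ ∈ cyclesOn s := by
  rw [mem_cyclesOn] at hδ
  obtain ⟨hfix, hcyc⟩ := hδ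
  have hδf : δ f ≠ f := by
    intro h
    have := hcyc {f} (by simp) (by simp) (by simp [h])
    obtain ⟨y, hy⟩ := hs
    have hy' : y ∈ ({f} : Finset α) := this ▸ Finset.mem_insert_of_mem hy
    exact hf (Finset.mem_singleton.1 hy' ▸ hy)
  have hmem : δ f ∈ s := (Finset.mem_insert.1
    ((apply_mem_iff_of_fixes hfix f).2 (Finset.mem_insert_self f s))).resolve_left hδf
  refine ⟨hmem, mem_cyclesOn.2 ⟨fun y hy => ?_, fun T hT hne hcl => ?_⟩⟩
  · by_cases hyf : y = f
    · simp [hyf]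
    · have := hfix y (by simp [hyf, hy])
      rw [Perm.mul_apply, this, swap_apply_of_ne_of_ne hyf]
      rintro rfl
      exact hy hmem
  · have hfT : f ∉ T := fun h => hf (hT h)
    have key : ∀ y ∈ T, δ y ≠ f → δ y ∈ T := fun y hy hyf => by
      have h1 := hcl y hy
      rwa [Perm.mul_apply, swap_apply_of_ne_of_ne hyf] at h1
      intro h
      exact hfT (δ.injective h ▸ hy)
    by_cases hp : ∃ y ∈ T, δ y = f
    · obtain ⟨p, hpT, hpf⟩ := hp
      have hfc : δ f ∈ T := by
        have h1 := hcl p hpT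
        rwa [Perm.mul_apply, hpf, swap_apply_left] at h1
      have := hcyc (insert f T) (Finset.insert_subset_insert f hT) (by simp) (by
        intro y hy
        rcases Finset.mem_insert.1 hy with rfl | hy
        · exact Finset.mem_insert_of_mem hfc
        · by_cases hyf : δ y = f
          · simp [hyf]
          · exact Finset.mem_insert_of_mem (key y hy hyf))
      rw [← Finset.erase_insert hfT, this, Finset.erase_insert hf]
    · push Not at hp
      have := hcyc T (hT.trans (Finset.subset_insert f s)) hne fun y hy => key y hy (hp y hy)
      exact absurd (this ▸ Finset.mem_insert_self f s) hfT

theorem sum_cyclesOn_insert {M : Type*} [AddCommMonoid M] {s : Finset α} {f : α} (hf : f ∉ s)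
    (hs : s.Nonempty) (F : Perm α → M) :
    ∑ δ ∈ cyclesOn (insert f s), F δ = ∑ x ∈ s, ∑ γ ∈ cyclesOn s, F (swap f x * γ) := by
  rw [← Finset.sum_product']
  symm
  refine Finset.sum_bij' (fun q _ => swap f q.1 * q.2) (fun δ _ => (δ f, swap f (δ f) * δ))
    ?_ ?_ ?_ ?_ ?_
  · rintro ⟨x, γ⟩ h
    rw [Finset.mem_product] at h
    exact swap_mul_mem_cyclesOn hf h.1 h.2
  · intro δ h
    exact Finset.mem_product.2 (swap_mul_mem_cyclesOn_of_insert hf hs h)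
  · rintro ⟨x, γ⟩ h
    rw [Finset.mem_product] at h
    have := (mem_cyclesOn.1 h.2).1 f hf
    simp [this]
  · intro δ h
    simp
  · intros
    rfl

theorem sum_cyclesOn_inv {M : Type*} [AddCommMonoid M] (s : Finset α) (F : Perm α → M) :
    ∑ δ ∈ cyclesOn s, F δ⁻¹ = ∑ δ ∈ cyclesOn s, F δ :=
  Finset.sum_bij' (fun δ _ => δ⁻¹) (fun δ _ => δ⁻¹) (fun _ h => inv_mem_cyclesOn h)
    (fun _ h => inv_mem_cyclesOn h) (by simp) (by simp) (by simp)

theorem sum_cyclesOn_insert' {M : Type*} [AddCommMonoid M] {s : Finset α} {f : α} (hf : f ∉ s)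
    (hs : s.Nonempty) (F : Perm α → M) :
    ∑ δ ∈ cyclesOn (insert f s), F δ = ∑ x ∈ s, ∑ γ ∈ cyclesOn s, F (γ * swap f x) := by
  rw [← sum_cyclesOn_inv, sum_cyclesOn_insert hf hs]
  refine Finset.sum_congr rfl fun x _ => ?_
  rw [← sum_cyclesOn_inv]
  simp [mul_inv_rev]

theorem sum_permsOn_insert {M : Type*} [AddCommMonoid M] {s : Finset α} {f : α} (hf : f ∉ s)
    (u : ℤˣ) (F : Perm α → M) :
    ∑ δ ∈ permsOn u (insert f s), F δ =
      ∑ δ ∈ permsOn u s, F δ + ∑ x ∈ s, ∑ γ ∈ permsOn (-u) s, F (swap f x * γ) := by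
  rw [← Finset.sum_filter_add_sum_filter_not (permsOn u (insert f s)) (fun δ => δ f = f)]
  congr 1
  · refine Finset.sum_congr ?_ fun _ _ => rfl
    ext δ
    simp only [Finset.mem_filter, mem_permsOn, Finset.mem_insert, not_or]
    constructor
    · rintro ⟨⟨h1, h2⟩, h3⟩
      refine ⟨fun x hx => ?_, h2⟩
      by_cases hxf : x = f
      · rw [hxf, h3]
      · exact h1 x ⟨hxf, hx⟩
    · rintro ⟨h1, h2⟩
      exact ⟨⟨fun x hx => h1 x hx.2, h2⟩, h1 f hf⟩
  · rw [← Finset.sum_product']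
    symm
    refine Finset.sum_bij' (fun q _ => swap f q.1 * q.2) (fun δ _ => (δ f, swap f (δ f) * δ))
      ?_ ?_ ?_ ?_ ?_
    · rintro ⟨x, γ⟩ h
      rw [Finset.mem_product, mem_permsOn] at h
      obtain ⟨hx, h1, h2⟩ := h
      have hxf : x ≠ f := fun h => hf (h ▸ hx)
      dsimp only at *
      rw [Finset.mem_filter, mem_permsOn]
      refine ⟨⟨fun y hy => ?_, by simp [h2, Perm.sign_swap hxf.symm]⟩, by simp [h1 f hf, hxf]⟩
      rw [Finset.mem_insert, not_or] at hy
      rw [Perm.mul_apply, h1 y hy.2, swap_apply_of_ne_of_ne hy.1]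
      rintro rfl
      exact hy.2 hx
    · intro δ h
      rw [Finset.mem_filter, mem_permsOn] at h
      obtain ⟨⟨h1, h2⟩, h3⟩ := h
      have hmem : δ f ∈ s := (Finset.mem_insert.1
        ((apply_mem_iff_of_fixes h1 f).2 (Finset.mem_insert_self f s))).resolve_left h3
      refine Finset.mem_product.2 ⟨hmem, mem_permsOn.2 ⟨fun y hy => ?_, ?_⟩⟩
      · by_cases hyf : y = f
        · simp [hyf]
        · have := h1 y (by simp [hyf, hy])
          dsimp only
          rw [Perm.mul_apply, this, swap_apply_of_ne_of_ne hyf]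
          rintro rfl
          exact hy hmem
      · simp [h2, Perm.sign_swap (Ne.symm h3)]
    · rintro ⟨x, γ⟩ h
      rw [Finset.mem_product, mem_permsOn] at h
      simp [h.2.1 f hf]
    · intro δ h
      simp
    · intros
      rfl

theorem cyclesOn_singleton (a : α) : cyclesOn ({a} : Finset α) = {1} := by
  ext σ
  rw [mem_cyclesOn, Finset.mem_singleton]
  constructor
  · rintro ⟨h, -⟩
    ext x
    by_cases hx : x = a
    · subst hx
      simpa using apply_mem_iff_of_fixes h x
    · simpa using h x (by simpa using hx)
  · rintro rfl
    refine ⟨fun _ _ => rfl, fun T hT hne _ => ?_⟩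
    exact (Finset.subset_singleton_iff.1 hT).resolve_left hne.ne_empty

theorem permsOn_singleton (u : ℤˣ) (a : α) :
    permsOn u ({a} : Finset α) = if u = 1 then {1} else ∅ := by
  ext σ
  have : σ ∈ permsOn u ({a} : Finset α) ↔ σ = 1 ∧ u = 1 := by
    rw [mem_permsOn]
    constructor
    · rintro ⟨h, h2⟩
      have : σ = 1 := by
        ext x
        by_cases hx : x = a
        · subst hx
          simpa using apply_mem_iff_of_fixes h x
        · simpa using h x (by simpa using hx)
      subst this
      simp_all
    · rintro ⟨rfl, rfl⟩
      simp
  rw [this]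
  split_ifs with h <;> simp [h]

theorem sum_swap_mul_swap_mul_permsOn {s : Finset α} {f : α} (hf : f ∉ s) (u : ℤˣ)
    (F : Perm α → ℤ) :
    ∑ x ∈ s, ∑ y ∈ s, ∑ σ ∈ permsOn u s, F (swap f x * (σ * swap f y)) =
      (s.card - 1) * ∑ σ ∈ permsOn u (insert f s), F σ + ∑ σ ∈ permsOn u s, F σ := by
  have h1 : ∀ x ∈ s, ∑ y ∈ s, ∑ σ ∈ permsOn u s, F (swap f x * (σ * swap f y)) =
      ∑ z ∈ s, ∑ σ ∈ permsOn u s, F (swap f x * swap f z * σ) := by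
    intro x _
    rw [Finset.sum_comm, Finset.sum_comm (s := s)]
    refine Finset.sum_congr rfl fun σ hσ => ?_
    have hfix := (mem_permsOn.1 hσ).1
    refine Finset.sum_equiv σ (fun y => (apply_mem_iff_of_fixes hfix y).symm) fun y _ => ?_
    rw [mul_swap_eq_swap_mul, hfix f hf]
    simp only [mul_assoc]
  rw [Finset.sum_congr rfl h1, Finset.sum_comm]
  have h2 : ∀ z ∈ s, ∑ x ∈ s, ∑ σ ∈ permsOn u s, F (swap f x * swap f z * σ) =
      ∑ σ ∈ permsOn u s, F σ +
        (s.card - 1) * ∑ τ ∈ permsOn (-u) s, F (swap f z * τ) := by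
    intro z hz
    rw [← Finset.add_sum_erase s _ hz]
    congr 1
    · simp
    · have h3 : ∀ x ∈ s.erase z, ∑ σ ∈ permsOn u s, F (swap f x * swap f z * σ) =
          ∑ τ ∈ permsOn (-u) s, F (swap f z * τ) := by
        intro x hx
        obtain ⟨hxz, hxs⟩ := Finset.mem_erase.1 hx
        have hxf : x ≠ f := fun h => hf (h ▸ hxs)
        have hzf : z ≠ f := fun h => hf (h ▸ hz)
        have hmem : ∀ v : ℤˣ, ∀ σ ∈ permsOn v s, swap z x * σ ∈ permsOn (-v) s := by
          intro v σ hσ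
          obtain ⟨ha, hb⟩ := mem_permsOn.1 hσ
          refine mem_permsOn.2 ⟨fun y hy => ?_, by simp [hb, Perm.sign_swap hxz.symm]⟩
          rw [Perm.mul_apply, ha y hy, swap_apply_of_ne_of_ne]
          · rintro rfl; exact hy hz
          · rintro rfl; exact hy hxs
        have hsw : swap f x * swap f z = swap f z * swap z x := by
          rw [mul_swap_eq_swap_mul (swap f z), swap_apply_right,
            swap_apply_of_ne_of_ne hxf hxz]
        refine Finset.sum_bij' (fun σ _ => swap z x * σ) (fun σ _ => swap z x * σ)
          (hmem u) (fun σ hσ => by simpa using hmem _ σ hσ) (by simp) (by simp) fun σ _ => ?_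
        rw [hsw, mul_assoc]
      rw [Finset.sum_congr rfl h3, Finset.sum_const, Finset.card_erase_of_mem hz, nsmul_eq_mul,
        Nat.cast_sub (Finset.card_pos.2 ⟨z, hz⟩)]
      simp
  rw [Finset.sum_congr rfl h2, Finset.sum_add_distrib, ← Finset.mul_sum, sum_permsOn_insert hf,
    Finset.sum_const, nsmul_eq_mul]
  ring

theorem sum_cyclesOn_mul_swap {s : Finset α} {f : α} (hf : f ∉ s) (hs : 2 ≤ s.card)
    (F : Perm α → ℤ) :
    ∑ e ∈ s, ∑ x ∈ s, ∑ γ ∈ cyclesOn s, ∑ β ∈ cyclesOn (s.erase e),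
        F (swap f x * (γ * β * swap f e)) =
      ∑ γ ∈ cyclesOn (insert f s), ∑ β ∈ cyclesOn s, F (γ * β) +
        ∑ e ∈ s, ∑ γ ∈ cyclesOn s, ∑ β ∈ cyclesOn (s.erase e), F (γ * β) := by
  have hne : s.Nonempty := Finset.card_pos.1 (by omega)
  have h1 : ∀ e ∈ s, ∑ x ∈ s, ∑ γ ∈ cyclesOn s, ∑ β ∈ cyclesOn (s.erase e),
        F (swap f x * (γ * β * swap f e)) =
      ∑ γ ∈ cyclesOn s, ∑ β ∈ cyclesOn s, F (swap f (γ e) * γ * β) +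
        ∑ γ ∈ cyclesOn s, ∑ β ∈ cyclesOn (s.erase e), F (γ * β) := by
    intro e he
    rw [Finset.sum_comm, ← Finset.sum_add_distrib]
    refine Finset.sum_congr rfl fun γ hγ => ?_
    have hfix := (mem_cyclesOn.1 hγ).1
    have hef : e ≠ f := fun h => hf (h ▸ he)
    have h2 : ∀ x, ∀ β ∈ cyclesOn (s.erase e),
        swap f x * (γ * β * swap f e) = swap f x * swap f (γ e) * γ * β := by
      intro x β hβ
      have hfixβ := (mem_cyclesOn.1 hβ).1
      rw [mul_assoc γ, commute_swap_of_fixes (hfixβ f (by simp [hf])) (hfixβ e (by simp)),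
        ← mul_assoc γ, mul_swap_eq_swap_mul, hfix f hf]
      simp only [mul_assoc]
    have h3 : ∑ x ∈ s, ∑ β ∈ cyclesOn (s.erase e), F (swap f x * (γ * β * swap f e)) =
        ∑ y ∈ s, ∑ β ∈ cyclesOn (s.erase e), F (swap f (γ y) * swap f (γ e) * γ * β) := by
      symm
      refine Finset.sum_equiv γ (fun y => (apply_mem_iff_of_fixes hfix y).symm) fun y _ => ?_
      exact Finset.sum_congr rfl fun β hβ => by rw [h2 _ β hβ]
    rw [h3, ← Finset.add_sum_erase s _ he, add_comm]
    congr 1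
    · have hne' : (s.erase e).Nonempty := by
        rw [← Finset.card_pos, Finset.card_erase_of_mem he]
        omega
      conv_rhs => rw [← Finset.insert_erase he]
      rw [sum_cyclesOn_insert (Finset.notMem_erase e s) hne']
      refine Finset.sum_congr rfl fun y hy => Finset.sum_congr rfl fun β hβ => ?_
      obtain ⟨hye, hys⟩ := Finset.mem_erase.1 hy
      have hγy : γ y ≠ f := fun h => hf (h ▸ (apply_mem_iff_of_fixes hfix y).2 hys)
      have hγye : γ y ≠ γ e := fun h => hye (γ.injective h)
      have hsw : swap f (γ y) * swap f (γ e) = swap f (γ e) * swap (γ e) (γ y) := by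
        rw [mul_swap_eq_swap_mul (swap f (γ e)), swap_apply_right,
          swap_apply_of_ne_of_ne hγy hγye]
      rw [hsw, mul_assoc (swap f (γ e)), ← mul_swap_eq_swap_mul]
      simp only [mul_assoc]
    · simp
  rw [Finset.sum_congr rfl h1, Finset.sum_add_distrib]
  congr 1
  rw [sum_cyclesOn_insert hf hne, Finset.sum_comm, Finset.sum_comm (s := s)]
  refine Finset.sum_congr rfl fun γ hγ => ?_
  have hfix := (mem_cyclesOn.1 hγ).1
  exact Finset.sum_equiv γ (fun y => (apply_mem_iff_of_fixes hfix y).symm) fun y _ => rfl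

/-- Products of a full cycle and an almost full cycle are equidistributed on odd permutations. -/
theorem sum_cyclesOn_mul_cyclesOn_erase {s : Finset α} (hs : 2 ≤ s.card) (F : Perm α → ℤ) :
    ∑ e ∈ s, ∑ γ ∈ cyclesOn s, ∑ β ∈ cyclesOn (s.erase e), F (γ * β) =
      2 * (s.card - 2).factorial * ∑ σ ∈ permsOn (-1) s, F σ := by
  induction s using Finset.induction_on generalizing F with
  | empty => simp at hs
  | insert f s hf ih =>
    rw [Finset.card_insert_of_notMem hf] at hs ⊢
    rcases Nat.lt_or_ge s.card 2 with hlt | hge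
    · obtain ⟨b, rfl⟩ := Finset.card_eq_one.1 (show s.card = 1 by omega)
      have hfb : f ≠ b := by simpa using hf
      have he : ∀ e ∈ ({f, b} : Finset α), cyclesOn (({f, b} : Finset α).erase e) = {1} := by
        intro e he
        rcases Finset.mem_insert.1 he with rfl | he
        · rw [Finset.erase_insert hf, cyclesOn_singleton]
        · rw [Finset.mem_singleton.1 he, Finset.erase_insert_of_ne hfb, Finset.erase_singleton,
            insert_empty_eq, cyclesOn_singleton]
      rw [Finset.sum_congr rfl fun e h => by rw [he e h], sum_permsOn_insert hf]
      rw [Finset.sum_const]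
      simp [sum_cyclesOn_insert hf, cyclesOn_singleton, permsOn_singleton, hfb]
    · have hne : s.Nonempty := Finset.card_pos.1 (by omega)
      have h1 : ∀ e ∈ s, ∑ γ ∈ cyclesOn (insert f s),
          ∑ β ∈ cyclesOn ((insert f s).erase e), F (γ * β) =
          ∑ x ∈ s, ∑ y ∈ s, ∑ γ ∈ cyclesOn s, ∑ β ∈ cyclesOn (s.erase e),
            F (swap f x * (γ * β * swap f y)) -
          ∑ x ∈ s, ∑ γ ∈ cyclesOn s, ∑ β ∈ cyclesOn (s.erase e),
            F (swap f x * (γ * β * swap f e)) := by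
        intro e he
        have hef : f ≠ e := fun h => hf (h ▸ he)
        have hne' : (s.erase e).Nonempty := by
          rw [← Finset.card_pos, Finset.card_erase_of_mem he]
          omega
        rw [sum_cyclesOn_insert hf hne, ← Finset.sum_sub_distrib]
        refine Finset.sum_congr rfl fun x _ => ?_
        rw [← Finset.add_sum_erase s _ he, add_sub_cancel_left, Finset.sum_comm (s := s.erase e)]
        refine Finset.sum_congr rfl fun γ _ => ?_
        rw [Finset.erase_insert_of_ne hef, sum_cyclesOn_insert' (by simp [hf]) hne']
        simp only [mul_assoc]
      have h2 : ∑ e ∈ s, ∑ x ∈ s, ∑ y ∈ s, ∑ γ ∈ cyclesOn s, ∑ β ∈ cyclesOn (s.erase e),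
            F (swap f x * (γ * β * swap f y)) =
          2 * (s.card - 2).factorial *
            ∑ x ∈ s, ∑ y ∈ s, ∑ σ ∈ permsOn (-1) s, F (swap f x * (σ * swap f y)) := by
        rw [Finset.sum_comm, Finset.mul_sum]
        refine Finset.sum_congr rfl fun x _ => ?_
        rw [Finset.sum_comm, Finset.mul_sum]
        refine Finset.sum_congr rfl fun y _ => ?_
        exact ih hge fun σ => F (swap f x * (σ * swap f y))
      rw [Finset.sum_insert hf, Finset.erase_insert hf, Finset.sum_congr rfl h1,
        Finset.sum_sub_distrib, h2, sum_swap_mul_swap_mul_permsOn hf,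
        sum_cyclesOn_mul_swap hf hge, ih hge]
      have h3 : (s.card + 1 - 2).factorial = (s.card - 1) * (s.card - 2).factorial := by
        obtain ⟨k, hk⟩ := Nat.exists_eq_add_of_le hge
        rw [hk, show 2 + k + 1 - 2 = k + 1 by omega, show 2 + k - 1 = k + 1 by omega,
          show 2 + k - 2 = k by omega, Nat.factorial_succ]
      rw [h3]
      push_cast [Nat.cast_sub (show 1 ≤ s.card by omega)]
      ring

theorem card_cyclesOn {s : Finset α} (hs : s.Nonempty) :
    (cyclesOn s).card = (s.card - 1).factorial := by
  induction hs using Finset.Nonempty.cons_induction with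
  | singleton a => simp [cyclesOn_singleton]
  | cons f s hf hs ih =>
    rw [Finset.cons_eq_insert, Finset.card_eq_sum_ones, sum_cyclesOn_insert hf hs,
      Finset.card_insert_of_notMem hf, Nat.add_sub_cancel]
    simp only [Finset.sum_const, smul_eq_mul, mul_one, ih]
    exact Nat.mul_factorial_pred (Finset.card_pos.2 hs).ne'

theorem sign_of_mem_cyclesOn {s : Finset α} (hs : s.Nonempty) {γ : Perm α}
    (hγ : γ ∈ cyclesOn s) : Perm.sign γ = (-1) ^ (s.card - 1) := by
  induction hs using Finset.Nonempty.cons_induction generalizing γ with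
  | singleton a => simp_all [cyclesOn_singleton]
  | cons f s hf hs ih =>
    rw [Finset.cons_eq_insert] at hγ ⊢
    obtain ⟨h1, h2⟩ := swap_mul_mem_cyclesOn_of_insert hf hs hγ
    have h3 := ih h2
    have hne : f ≠ γ f := fun h => hf (h ▸ h1)
    rw [Perm.sign_mul, Perm.sign_swap hne] at h3
    rw [Finset.card_insert_of_notMem hf, Nat.add_sub_cancel,
      ← Nat.sub_add_cancel (Finset.card_pos.2 hs), pow_succ, ← h3]
    simp

theorem conj_mem_cyclesOn {s : Finset α} {γ : Perm α} (g : Perm α) (hγ : γ ∈ cyclesOn s) :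
    g * γ * g⁻¹ ∈ cyclesOn (s.image g) := by
  rw [mem_cyclesOn] at hγ ⊢
  refine ⟨fun x hx => ?_, fun T hT hne hcl => ?_⟩
  · have : g⁻¹ x ∉ s := fun h => hx (Finset.mem_image.2 ⟨_, h, by simp⟩)
    rw [Perm.mul_apply, Perm.mul_apply, hγ.1 _ this]
    simp
  · have h1 : (T.image (g⁻¹ : Perm α)).image g = T := by simp [Finset.image_image]
    rw [← h1]
    congr 1
    refine hγ.2 _ ?_ (hne.image _) ?_
    · intro x hx
      obtain ⟨y, hy, rfl⟩ := Finset.mem_image.1 hx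
      obtain ⟨z, hz, rfl⟩ := Finset.mem_image.1 (hT hy)
      simpa using hz
    · intro x hx
      obtain ⟨y, hy, rfl⟩ := Finset.mem_image.1 hx
      exact Finset.mem_image.2 ⟨_, hcl y hy, by simp⟩

theorem sum_cyclesOn_conj {M : Type*} [AddCommMonoid M] (s : Finset α) (g : Perm α)
    (F : Perm α → M) :
    ∑ γ ∈ cyclesOn s, F (g * γ * g⁻¹) = ∑ γ ∈ cyclesOn (s.image g), F γ := by
  refine Finset.sum_bij' (fun γ _ => g * γ * g⁻¹) (fun γ _ => g⁻¹ * γ * g)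
    (fun γ h => conj_mem_cyclesOn g h) (fun γ h => ?_) ?_ ?_ fun _ _ => rfl
  · simpa [Finset.image_image] using conj_mem_cyclesOn g⁻¹ h
  · intros; group
  · intros; group

/-- The number of pairs of cycles on `s` whose product is again a cycle on `s`. -/
def cycleTriples (s : Finset α) : ℕ :=
  ∑ γ ∈ cyclesOn s, ∑ β ∈ cyclesOn s, if γ * β ∈ cyclesOn s then 1 else 0

theorem swap_mul_mem_cyclesOn_iff {s : Finset α} {f x : α} (hf : f ∉ s) (hx : x ∈ s)
    {τ : Perm α} (hτ : τ f = f) : swap f x * τ ∈ cyclesOn (insert f s) ↔ τ ∈ cyclesOn s := by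
  refine ⟨fun h => ?_, fun h => swap_mul_mem_cyclesOn hf hx h⟩
  simpa [hτ] using (swap_mul_mem_cyclesOn_of_insert hf ⟨x, hx⟩ h).2

theorem card_mul_cycleTriples {s : Finset α} {f : α} (hf : f ∉ s) (hs : Odd s.card) :
    (s.card + 1) * (s.card * cycleTriples s) =
      2 * (s.card - 1).factorial * s.card.factorial := by
  have hne : s.Nonempty := Finset.card_pos.1 hs.pos
  set F : Perm α → ℤ := fun σ => if σ ∈ cyclesOn (insert f s) then 1 else 0 with hF
  have hcard : (insert f s).card = s.card + 1 := Finset.card_insert_of_notMem hf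
  have h1 := sum_cyclesOn_mul_cyclesOn_erase (s := insert f s)
    (by rw [hcard]; have := hs.pos; omega) F
  have h2 : ∑ σ ∈ permsOn (-1) (insert f s), F σ = (s.card.factorial : ℕ) := by
    rw [hF, Finset.sum_ite_mem, Finset.inter_eq_right.2, Finset.sum_const,
      card_cyclesOn (Finset.insert_nonempty f s), hcard]
    · simp
    · intro γ hγ
      refine mem_permsOn.2 ⟨(mem_cyclesOn.1 hγ).1, ?_⟩
      rw [sign_of_mem_cyclesOn (Finset.insert_nonempty f s) hγ, hcard, Nat.add_sub_cancel,
        hs.neg_one_pow]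
  have h3 : ∑ γ ∈ cyclesOn (insert f s), ∑ β ∈ cyclesOn s, F (γ * β) =
      (s.card * cycleTriples s : ℕ) := by
    rw [sum_cyclesOn_insert hf hne, cycleTriples]
    push_cast
    rw [← nsmul_eq_mul, ← Finset.sum_const]
    refine Finset.sum_congr rfl fun x hx => Finset.sum_congr rfl fun γ hγ =>
      Finset.sum_congr rfl fun β hβ => ?_
    have hfix : (γ * β) f = f := by
      rw [Perm.mul_apply, (mem_cyclesOn.1 hβ).1 f hf, (mem_cyclesOn.1 hγ).1 f hf]
    simp only [hF, mul_assoc, swap_mul_mem_cyclesOn_iff hf hx hfix]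
  have h4 : ∀ e ∈ insert f s, ∑ γ ∈ cyclesOn (insert f s),
      ∑ β ∈ cyclesOn ((insert f s).erase e), F (γ * β) = (s.card * cycleTriples s : ℕ) := by
    intro e he
    have hmap : ∀ x, swap f e x ∈ insert f s ↔ x ∈ insert f s := by
      refine apply_mem_iff_of_fixes fun x hx => swap_apply_of_ne_of_ne ?_ ?_
      · rintro rfl; simp at hx
      · rintro rfl; exact hx he
    have hi1 : (insert f s).image (swap f e) = insert f s := by
      refine Finset.eq_of_subset_of_card_le (fun y hy => ?_) ?_
      · obtain ⟨x, hx, rfl⟩ := Finset.mem_image.1 hy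
        exact (hmap x).2 hx
      · rw [Finset.card_image_of_injective _ (swap f e).injective]
    have hi2 : s.image (swap f e) = (insert f s).erase e := by
      conv_rhs => rw [← hi1]
      nth_rw 3 [← swap_apply_left f e]
      rw [← Finset.image_erase (swap f e).injective, Finset.erase_insert hf]
    rw [← h3]
    conv_lhs => rw [← hi1]
    rw [hi1, ← hi2]
    conv_lhs => rw [← hi1, ← sum_cyclesOn_conj]
    refine Finset.sum_congr rfl fun γ _ => ?_
    rw [← sum_cyclesOn_conj]
    refine Finset.sum_congr rfl fun β _ => ?_
    have : swap f e * γ * (swap f e)⁻¹ * (swap f e * β * (swap f e)⁻¹) =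
        swap f e * (γ * β) * (swap f e)⁻¹ := by group
    rw [this]
    simp only [hF]
    congr 1
    refine propext ⟨fun h => ?_, fun h => ?_⟩
    · have := conj_mem_cyclesOn (swap f e)⁻¹ h
      rw [swap_inv, hi1] at this
      simpa [mul_assoc] using this
    · have := conj_mem_cyclesOn (swap f e) h
      rwa [hi1] at this
  rw [Finset.sum_congr rfl h4, Finset.sum_const, h2, hcard, nsmul_eq_mul] at h1
  exact_mod_cast h1

theorem optionCongr_mem_cyclesOn {σ : Perm α} :
    optionCongr σ ∈ cyclesOn ((Finset.univ : Finset α).map Function.Embedding.some) ↔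
      σ ∈ cyclesOn (Finset.univ : Finset α) := by
  rw [mem_cyclesOn, mem_cyclesOn]
  constructor
  · rintro ⟨-, h⟩
    refine ⟨by simp, fun T _ hne hcl => ?_⟩
    refine Finset.map_injective Function.Embedding.some
      (h (T.map Function.Embedding.some) (Finset.map_subset_map.2 (Finset.subset_univ T))
        (hne.map) ?_)
    simpa using hcl
  · rintro ⟨-, h⟩
    refine ⟨fun x hx => ?_, fun T hT hne hcl => ?_⟩
    · cases x with
      | none => rfl
      | some x => simp at hx
    · obtain ⟨U, -, rfl⟩ := Finset.subset_map_iff.1 hT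
      rw [h U (Finset.subset_univ U) (by simpa using hne)]
      simpa using hcl

theorem sum_cyclesOn_map_some {M : Type*} [AddCommMonoid M] (F : Perm (Option α) → M) :
    ∑ γ ∈ cyclesOn ((Finset.univ : Finset α).map Function.Embedding.some), F γ =
      ∑ γ ∈ cyclesOn (Finset.univ : Finset α), F (optionCongr γ) := by
  have hr : ∀ γ ∈ cyclesOn ((Finset.univ : Finset α).map Function.Embedding.some),
      optionCongr (removeNone γ) = γ := by
    intro γ hγ
    have h0 : γ none = none := (mem_cyclesOn.1 hγ).1 none (by simp)
    rw [map_equiv_removeNone, h0, swap_self]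
    exact one_mul γ
  refine Finset.sum_bij' (fun γ _ => removeNone γ) (fun γ _ => optionCongr γ) ?_ ?_ ?_ ?_ ?_
  · intro γ hγ
    rwa [← optionCongr_mem_cyclesOn, hr γ hγ]
  · intro γ hγ
    rwa [optionCongr_mem_cyclesOn]
  · exact hr
  · intros; simp
  · intro γ hγ
    rw [hr γ hγ]

theorem cycleTriples_univ_option :
    cycleTriples ((Finset.univ : Finset α).map Function.Embedding.some) =
      cycleTriples (Finset.univ : Finset α) := by
  rw [cycleTriples, sum_cyclesOn_map_some]
  refine Finset.sum_congr rfl fun γ _ => ?_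
  rw [sum_cyclesOn_map_some]
  refine Finset.sum_congr rfl fun β _ => ?_
  have : (optionCongr γ : Perm (Option α)) * optionCongr β = optionCongr (γ * β) := by
    ext x; cases x <;> rfl
  simp only [this, optionCongr_mem_cyclesOn]

theorem exists_pow_apply_eq {σ : Perm α} (hσ : σ ∈ cyclesOn (Finset.univ : Finset α))
    (x y : α) : ∃ k : ℕ, (σ ^ k) x = y := by
  classical
  have := (mem_cyclesOn.1 hσ).2 {y | ∃ k : ℕ, (σ ^ k) x = y} (Finset.subset_univ _)
    ⟨x, by simpa using ⟨0, rfl⟩⟩ (by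
      intro y hy
      rw [Finset.mem_filter] at hy ⊢
      obtain ⟨-, k, rfl⟩ := hy
      exact ⟨Finset.mem_univ _, k + 1, by rw [pow_succ']; rfl⟩)
  have hy := this.symm ▸ Finset.mem_univ y
  simpa using hy

theorem sum_conj_eq [Nonempty α] {M : Type*} [AddCommMonoid M] {S : Perm α}
    (hS : S ∈ cyclesOn (Finset.univ : Finset α)) (F : Perm α → M) :
    ∑ σ : Perm α, F (σ * S * σ⁻¹) =
      Fintype.card α • ∑ τ ∈ cyclesOn (Finset.univ : Finset α), F τ := by
  obtain ⟨x₀⟩ := ‹Nonempty α›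
  let g : Perm α → α × Perm α := fun σ => (σ x₀, σ * S * σ⁻¹)
  have hg : Function.Injective g := by
    intro σ τ h
    obtain ⟨h1, h2⟩ := Prod.mk.inj h
    ext y
    obtain ⟨k, rfl⟩ := exists_pow_apply_eq hS x₀ y
    have e1 : σ * S ^ k = (σ * S * σ⁻¹) ^ k * σ := by rw [conj_pow]; group
    have e2 : τ * S ^ k = (τ * S * τ⁻¹) ^ k * τ := by rw [conj_pow]; group
    rw [← Perm.mul_apply, ← Perm.mul_apply, e1, e2, h2, Perm.mul_apply, Perm.mul_apply, h1]
  have himg : (Finset.univ : Finset (Perm α)).image g =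
      (Finset.univ : Finset α) ×ˢ cyclesOn (Finset.univ : Finset α) := by
    refine Finset.eq_of_subset_of_card_le (fun q hq => ?_) ?_
    · obtain ⟨σ, -, rfl⟩ := Finset.mem_image.1 hq
      refine Finset.mem_product.2 ⟨Finset.mem_univ _, ?_⟩
      simpa using conj_mem_cyclesOn σ hS
    · rw [Finset.card_product, card_cyclesOn ⟨x₀, Finset.mem_univ _⟩,
        Finset.card_image_of_injective _ hg, Finset.card_univ, Finset.card_univ,
        Fintype.card_perm, Nat.mul_factorial_pred (Fintype.card_ne_zero)]
  rw [← Finset.card_univ, ← Finset.sum_const, ← Finset.sum_product', ← himg,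
    Finset.sum_image hg.injOn]

/-- The number of `σ` for which the commutator-like permutation `σ S⁻¹ σ⁻¹ S` is a full cycle,
where `S` is a given full cycle. -/
theorem card_commutator_cycle [Nonempty α] (hodd : Odd (Fintype.card α)) {S : Perm α}
    (hS : S ∈ cyclesOn (Finset.univ : Finset α)) :
    (Fintype.card α + 1) * (Finset.univ.filter fun σ : Perm α =>
      σ * S⁻¹ * σ⁻¹ * S ∈ cyclesOn (Finset.univ : Finset α)).card =
      2 * (Fintype.card α).factorial := by
  set q := Fintype.card α with hq
  set C := cyclesOn (Finset.univ : Finset α) with hC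
  set W := (Finset.univ.filter fun σ : Perm α => σ * S⁻¹ * σ⁻¹ * S ∈ C).card with hW
  have hqpos : 0 < q := hodd.pos
  have h1 : (q + 1) * (q * cycleTriples (Finset.univ : Finset α)) =
      2 * (q - 1).factorial * q.factorial := by
    have := card_mul_cycleTriples (s := (Finset.univ : Finset α).map Function.Embedding.some)
      (f := none) (by simp) (by simpa using hodd)
    rwa [cycleTriples_univ_option, Finset.card_map, Finset.card_univ] at this
  have h2 : ∀ τ : Perm α, ∑ σ : Perm α,
      (if (σ * S⁻¹ * σ⁻¹) * (τ * S * τ⁻¹) ∈ C then 1 else 0) = W := by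
    intro τ
    rw [hW, Finset.card_filter]
    refine Fintype.sum_equiv (Equiv.mulLeft τ⁻¹) _ _ fun σ => ?_
    congr 1
    refine propext ⟨fun h => ?_, fun h => ?_⟩
    · have := conj_mem_cyclesOn τ⁻¹ h
      rw [Finset.image_univ_of_surjective (τ⁻¹ : Perm α).surjective] at this
      simpa [mul_assoc] using this
    · have := conj_mem_cyclesOn τ h
      rw [Finset.image_univ_of_surjective τ.surjective] at this
      simpa [mul_assoc] using this
  have h3 : q.factorial * W = q * (q * cycleTriples (Finset.univ : Finset α)) := by
    have e1 : ∑ τ : Perm α, ∑ σ : Perm α,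
        (if (σ * S⁻¹ * σ⁻¹) * (τ * S * τ⁻¹) ∈ C then 1 else 0) = q.factorial * W := by
      rw [Finset.sum_congr rfl fun τ _ => h2 τ, Finset.sum_const, Finset.card_univ,
        Fintype.card_perm, smul_eq_mul]
    rw [← e1, Finset.sum_comm, cycleTriples]
    rw [sum_conj_eq (inv_mem_cyclesOn hS)
      (fun γ => ∑ τ : Perm α, if γ * (τ * S * τ⁻¹) ∈ C then 1 else 0), smul_eq_mul]
    congr 1
    rw [Finset.mul_sum]
    refine Finset.sum_congr rfl fun γ _ => ?_
    rw [sum_conj_eq hS (fun δ => if γ * δ ∈ C then 1 else 0), smul_eq_mul]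
  have h4 := Nat.mul_factorial_pred hqpos.ne'
  have h5 : q.factorial * ((q + 1) * W) = q.factorial * (2 * q.factorial) := by
    calc q.factorial * ((q + 1) * W) = (q + 1) * (q.factorial * W) := by ring
      _ = q * ((q + 1) * (q * cycleTriples (Finset.univ : Finset α))) := by rw [h3]; ring
      _ = 2 * (q * (q - 1).factorial) * q.factorial := by rw [h1]; ring
      _ = _ := by rw [h4]; ring
  exact Nat.eq_of_mul_eq_mul_left (Nat.factorial_pos q) h5

end Cycles

section Periodic

theorem mem_cyclesOn_univ_iff {α : Type*} [DecidableEq α] [Fintype α] {σ : Perm α} :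
    σ ∈ cyclesOn (Finset.univ : Finset α) ↔ ∀ x y : α, ∃ k : ℕ, (σ ^ k) x = y := by
  refine ⟨exists_pow_apply_eq, fun h => mem_cyclesOn.2 ⟨by simp, fun T _ hne hcl => ?_⟩⟩
  obtain ⟨x, hx⟩ := hne
  refine Finset.eq_univ_of_forall fun y => ?_
  obtain ⟨k, rfl⟩ := h x y
  induction k with
  | zero => simpa using hx
  | succ k ih => rw [pow_succ']; exact hcl _ ih

theorem isCycleOn_of_mem_cyclesOn {α : Type*} [DecidableEq α] [Fintype α] {σ : Perm α}
    (h : σ ∈ cyclesOn (Finset.univ : Finset α)) :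
    σ.IsCycleOn ((Finset.univ : Finset α) : Set α) := by
  refine ⟨by simp, fun x _ y _ => ?_⟩
  obtain ⟨k, hk⟩ := exists_pow_apply_eq h x y
  exact ⟨k, by simpa using hk⟩

/-- The permutation sending `x` to the entry cyclically preceding `x + 1` in `π`. -/
def predSucc {N : ℕ} (π : Perm (ZMod N)) : Perm (ZMod N) :=
  π * (Equiv.addRight (1 : ZMod N))⁻¹ * π⁻¹ * Equiv.addRight (1 : ZMod N)

theorem predSucc_apply_sub_one {N : ℕ} (π : Perm (ZMod N)) (k : ZMod N) :
    predSucc π (π k - 1) = π (k - 1) := by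
  simp [predSucc, sub_eq_add_neg]

theorem addRight_one_mem_cyclesOn (N : ℕ) [NeZero N] :
    Equiv.addRight (1 : ZMod N) ∈ cyclesOn (Finset.univ : Finset (ZMod N)) := by
  rw [mem_cyclesOn_univ_iff]
  intro x y
  refine ⟨(y - x).val, ?_⟩
  have : ∀ k : ℕ, (Equiv.addRight (1 : ZMod N) ^ k) x = x + k := by
    intro k
    induction k with
    | zero => simp
    | succ k ih => rw [pow_succ', Perm.mul_apply, ih]; simp [add_assoc]
  rw [this]
  simp

variable {p m : ℕ}

/-- Reduction modulo `p` on `ZMod (p * m)`. -/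
def redMod (p m : ℕ) : ZMod (p * m) →+* ZMod p := ZMod.castHom (Dvd.intro m rfl) (ZMod p)

theorem redMod_natCast (a : ℕ) : redMod p m (a : ZMod (p * m)) = a := map_natCast _ _

theorem redMod_eq_natCast_val [NeZero (p * m)] (x : ZMod (p * m)) :
    redMod p m x = (x.val : ZMod p) := by
  conv_lhs => rw [← ZMod.natCast_zmod_val x]
  exact redMod_natCast _

theorem exists_eq_add_of_redMod_eq [NeZero p] [NeZero m] {x y : ZMod (p * m)}
    (h : redMod p m x = redMod p m y) : ∃ w : ℕ, y = x + p * w := by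
  obtain ⟨a, ha⟩ : ∃ a : ℕ, (a : ZMod (p * m)) = y - x := ⟨_, ZMod.natCast_zmod_val _⟩
  have h0 : (a : ZMod p) = 0 := by
    rw [← redMod_natCast (m := m), ha, map_sub, h, sub_self]
  obtain ⟨w, hw⟩ := (ZMod.natCast_eq_zero_iff _ _).1 h0
  refine ⟨w, ?_⟩
  rw [← Nat.cast_mul, ← hw, ha]
  ring

theorem natCast_mul_eq_zero : (p : ZMod (p * m)) * m = 0 := by
  rw [← Nat.cast_mul]
  exact ZMod.natCast_self _

theorem map_add_mul_natCast {N : ℕ} {f : ZMod N → ZMod N} {a b : ZMod N}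
    (h : ∀ k, f (k + a) = f k + b) (k : ZMod N) (w : ℕ) : f (k + a * w) = f k + b * w := by
  induction w with
  | zero => simp
  | succ w ih =>
    rw [Nat.cast_succ, mul_add, mul_one, ← add_assoc, h, ih]
    ring

variable [NeZero p] [NeZero m] {π : Perm (ZMod (p * m))} {σ : Perm (ZMod p)} {c : ℕ}

theorem predSucc_add (hπ : ∀ k, π (k + p) = π k + p * c) (hc : c.Coprime m)
    (x : ZMod (p * m)) (w : ℕ) : predSucc π (x + p * w) = predSucc π x + p * w := by
  refine map_add_mul_natCast (f := predSucc π) (fun x => ?_) x w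
  obtain ⟨a, b, hab⟩ := (Nat.isCoprime_iff_coprime.2 hc)
  set u : ℕ := (a : ZMod (p * m)).val with hu
  have hu' : (u : ZMod (p * m)) = (a : ZMod (p * m)) := by rw [hu]; simp
  have hab' : (a : ZMod (p * m)) * c + b * m = 1 := by
    have := congrArg (Int.cast : ℤ → ZMod (p * m)) hab
    push_cast at this
    exact this
  have h1 : ∀ k, π (k + p * u) = π k + p := by
    intro k
    rw [map_add_mul_natCast hπ, hu']
    linear_combination (p : ZMod (p * m)) * hab' - b * natCast_mul_eq_zero (p := p) (m := m)
  obtain ⟨k, rfl⟩ : ∃ k, x = π k - 1 := ⟨π⁻¹ (x + 1), by simp⟩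
  have h2 : π k - 1 + p = π (k + p * u) - 1 := by rw [h1]; ring
  rw [h2, predSucc_apply_sub_one, predSucc_apply_sub_one, ← h1]
  congr 1
  ring

theorem redMod_predSucc {p m : ℕ} {π : Perm (ZMod (p * m))} {σ : Perm (ZMod p)}
    (hσ : ∀ k, redMod p m (π k) = σ (redMod p m k)) (x : ZMod (p * m)) :
    redMod p m (predSucc π x) = predSucc σ (redMod p m x) := by
  obtain ⟨k, rfl⟩ : ∃ k, x = π k - 1 := ⟨π⁻¹ (x + 1), by simp⟩
  rw [predSucc_apply_sub_one, hσ, map_sub, map_sub (redMod p m), hσ, map_one,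
    predSucc_apply_sub_one]

theorem redMod_predSucc_pow {p m : ℕ} {π : Perm (ZMod (p * m))} {σ : Perm (ZMod p)}
    (hσ : ∀ k, redMod p m (π k) = σ (redMod p m k))
    (x : ZMod (p * m)) (j : ℕ) :
    redMod p m ((predSucc π ^ j) x) = (predSucc σ ^ j) (redMod p m x) := by
  induction j with
  | zero => simp
  | succ j ih => rw [pow_succ', Perm.mul_apply, redMod_predSucc hσ, ih, pow_succ', Perm.mul_apply]

theorem sum_zmod_eq_sum_range {M : Type*} [AddCommMonoid M] (f : ℕ → M) :
    ∑ j : ZMod p, f j.val = ∑ j ∈ Finset.range p, f j := by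
  obtain ⟨k, rfl⟩ := Nat.exists_eq_succ_of_ne_zero (NeZero.ne p)
  exact Fin.sum_univ_eq_sum_range f (k + 1)

theorem predSucc_pow_period (hπ : ∀ k, π (k + p) = π k + p * c) (hc : c.Coprime m)
    (hσ : ∀ k, redMod p m (π k) = σ (redMod p m k))
    (hcyc : predSucc σ ∈ cyclesOn (Finset.univ : Finset (ZMod p))) (x : ZMod (p * m)) :
    (predSucc π ^ p) x = x + p * (1 - c) := by
  set g : ZMod (p * m) → ZMod (p * m) := fun x => predSucc π x - x with hg
  have hgp : ∀ x y, redMod p m x = redMod p m y → g x = g y := by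
    intro x y h
    obtain ⟨w, rfl⟩ := exists_eq_add_of_redMod_eq h
    simp only [hg, predSucc_add hπ hc]
    ring
  set h : ZMod p → ZMod (p * m) := fun i => g (i.val : ZMod (p * m)) with hh
  have hgh : ∀ x, g x = h (redMod p m x) := fun x => hgp _ _ (by simp)
  have h1 : ∀ j : ℕ, (predSucc π ^ j) x =
      x + ∑ i ∈ Finset.range j, h ((predSucc σ ^ i) (redMod p m x)) := by
    intro j
    induction j with
    | zero => simp
    | succ j ih =>
      rw [Finset.sum_range_succ, ← add_assoc, ← ih, ← redMod_predSucc_pow hσ, ← hgh, pow_succ',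
        Perm.mul_apply]
      simp [hg]
  have hC := isCycleOn_of_mem_cyclesOn hcyc
  have h2 : ∑ i ∈ Finset.range p, h ((predSucc σ ^ i) (redMod p m x)) = ∑ z : ZMod p, h z := by
    have himg : (Finset.range p).image (fun i => (predSucc σ ^ i) (redMod p m x)) =
        Finset.univ := by
      refine Finset.eq_univ_of_forall fun z => ?_
      obtain ⟨n, hn, hz⟩ := hC.exists_pow_eq (Finset.mem_univ (redMod p m x)) (Finset.mem_univ z)
      exact Finset.mem_image.2 ⟨n, by simpa [ZMod.card] using hn, hz⟩
    rw [← himg, Finset.sum_image]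
    exact Finset.injOn_of_card_image_eq (by simp [himg, ZMod.card])
  have h3 : ∑ z : ZMod p, h z = ∑ j : ZMod p, h (σ j - 1) :=
    (Equiv.sum_comp (σ.trans (Equiv.subRight 1)) h).symm
  have h4 : ∀ j : ZMod p, h (σ j - 1) =
      π ((j.val : ZMod (p * m)) - 1) - π ((j.val + 1 : ℕ) - 1 : ZMod (p * m)) + 1 := by
    intro j
    have : redMod p m (π (j.val : ZMod (p * m)) - 1) = σ j - 1 := by
      rw [map_sub, hσ, redMod_natCast, map_one]
      simp
    rw [← this, ← hgh]
    simp only [hg, predSucc_apply_sub_one]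
    push_cast
    rw [add_sub_cancel_right]
    ring
  rw [h1, h2, h3, Finset.sum_congr rfl fun j _ => h4 j]
  rw [sum_zmod_eq_sum_range (fun j : ℕ =>
      π ((j : ZMod (p * m)) - 1) - π ((j + 1 : ℕ) - 1 : ZMod (p * m)) + 1),
    Finset.sum_add_distrib, Finset.sum_range_sub' (fun j : ℕ => π ((j : ZMod (p * m)) - 1))]
  have h5 : π ((p : ZMod (p * m)) - 1) = π (((0 : ℕ) : ZMod (p * m)) - 1) + p * c := by
    rw [← hπ]
    congr 1
    push_cast
    ring
  rw [h5]
  simp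
  ring

theorem predSucc_mem_cyclesOn_iff (hπ : ∀ k, π (k + p) = π k + p * c) (hc : c.Coprime m)
    (hc1 : 1 ≤ c) (hσ : ∀ k, redMod p m (π k) = σ (redMod p m k)) :
    predSucc π ∈ cyclesOn (Finset.univ : Finset (ZMod (p * m))) ↔
      predSucc σ ∈ cyclesOn (Finset.univ : Finset (ZMod p)) ∧ (c - 1).Coprime m := by
  have hpow : predSucc σ ∈ cyclesOn (Finset.univ : Finset (ZMod p)) → ∀ (x : ZMod (p * m)) (k : ℕ),
      (predSucc π ^ (p * k)) x = x + p * k * (1 - c) := by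
    intro hcyc x k
    induction k with
    | zero => simp
    | succ k ih =>
      rw [mul_add, mul_one, add_comm, pow_add, Perm.mul_apply, ih,
        predSucc_pow_period hπ hc hσ hcyc]
      push_cast
      ring
  constructor
  · intro h
    rw [mem_cyclesOn_univ_iff] at h
    have hcyc : predSucc σ ∈ cyclesOn (Finset.univ : Finset (ZMod p)) := by
      rw [mem_cyclesOn_univ_iff]
      intro x y
      obtain ⟨k, hk⟩ := h (x.val : ZMod (p * m)) (y.val : ZMod (p * m))
      refine ⟨k, ?_⟩
      have := redMod_predSucc_pow hσ (x.val : ZMod (p * m)) k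
      rw [hk, redMod_natCast, redMod_natCast] at this
      simpa using this.symm
    refine ⟨hcyc, ?_⟩
    obtain ⟨j, hj⟩ := h 0 (p : ZMod (p * m))
    have hj0 : (predSucc σ ^ j) 0 = 0 := by
      have := redMod_predSucc_pow hσ (0 : ZMod (p * m)) j
      rw [hj, redMod_natCast, map_zero] at this
      simpa using this.symm
    have hdvd := ((isCycleOn_of_mem_cyclesOn hcyc).pow_apply_eq (Finset.mem_univ 0)).1 hj0
    rw [Finset.card_univ, ZMod.card] at hdvd
    obtain ⟨k, rfl⟩ := hdvd
    rw [hpow hcyc, zero_add] at hj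
    have h1 : (((p : ℤ) * (k * (1 - c) - 1) : ℤ) : ZMod (p * m)) = 0 := by
      push_cast
      linear_combination hj
    rw [ZMod.intCast_zmod_eq_zero_iff_dvd, Nat.cast_mul] at h1
    have h2 := Int.dvd_of_mul_dvd_mul_left (by exact_mod_cast NeZero.ne p) h1
    obtain ⟨b, hb⟩ := h2
    rw [← Nat.isCoprime_iff_coprime]
    refine ⟨-k, -b, ?_⟩
    push_cast [hc1]
    linear_combination hb
  · rintro ⟨hcyc, hcop⟩
    rw [mem_cyclesOn_univ_iff]
    intro x y
    obtain ⟨j, hj⟩ := exists_pow_apply_eq hcyc (redMod p m x) (redMod p m y)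
    rw [← redMod_predSucc_pow hσ] at hj
    obtain ⟨w, hw⟩ := exists_eq_add_of_redMod_eq hj
    obtain ⟨a, b, hab⟩ := (Nat.isCoprime_iff_coprime.2 hcop)
    set k : ℕ := (-(a * w) : ZMod (p * m)).val with hk
    have hk' : (k : ZMod (p * m)) = -(a * w) := by rw [hk]; simp
    have hab' : (a : ZMod (p * m)) * (c - 1) + b * m = 1 := by
      have := congrArg (Int.cast : ℤ → ZMod (p * m)) hab
      push_cast [hc1] at this
      exact this
    refine ⟨p * k + j, ?_⟩
    rw [pow_add, Perm.mul_apply, hpow hcyc, hw, hk']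
    congr 1
    linear_combination (p : ZMod (p * m)) * w * hab' -
      b * w * natCast_mul_eq_zero (p := p) (m := m)

/-- The function on `ZMod (p * m)` with reduction `σ`, offsets `t` and increment `p * c` over
one period. -/
def periodicFun (p m : ℕ) (q : Perm (ZMod p) × (ZMod p → Fin m) × ℕ) (k : ZMod (p * m)) :
    ZMod (p * m) :=
  (((q.1 (k.val : ZMod p)).val + p * (q.2.1 (k.val : ZMod p)).val + p * (q.2.2 * (k.val / p)) : ℕ) :
    ZMod (p * m))

theorem periodicFun_natCast (q : Perm (ZMod p) × (ZMod p → Fin m) × ℕ) (a : ℕ) :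
    periodicFun p m q (a : ZMod (p * m)) =
      (((q.1 a).val + p * (q.2.1 a).val + p * (q.2.2 * (a / p)) : ℕ) : ZMod (p * m)) := by
  have hp : 0 < p := Nat.pos_of_ne_zero (NeZero.ne p)
  have h1 : (((a : ZMod (p * m)).val : ℕ) : ZMod p) = a := by
    rw [← redMod_eq_natCast_val, redMod_natCast]
  have h2 : a / p = m * (a / (p * m)) + (a : ZMod (p * m)).val / p := by
    rw [ZMod.val_natCast]
    conv_lhs => rw [← Nat.div_add_mod a (p * m), mul_assoc, Nat.mul_add_div hp]
  rw [periodicFun, h1, h2]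
  push_cast
  linear_combination (-(q.2.2 : ZMod (p * m)) * ((a / (p * m) : ℕ) : ZMod (p * m))) *
    natCast_mul_eq_zero (p := p) (m := m)

theorem periodicFun_add (q : Perm (ZMod p) × (ZMod p → Fin m) × ℕ) (k : ZMod (p * m)) :
    periodicFun p m q (k + p) = periodicFun p m q k + p * q.2.2 := by
  have hp : 0 < p := Nat.pos_of_ne_zero (NeZero.ne p)
  rw [← ZMod.natCast_zmod_val k, ← Nat.cast_add, periodicFun_natCast, periodicFun_natCast,
    Nat.add_div_right _ hp]
  push_cast
  rw [ZMod.natCast_self, add_zero]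
  ring

theorem redMod_periodicFun (q : Perm (ZMod p) × (ZMod p → Fin m) × ℕ) (k : ZMod (p * m)) :
    redMod p m (periodicFun p m q k) = q.1 (redMod p m k) := by
  rw [periodicFun, redMod_natCast, redMod_eq_natCast_val]
  simp

theorem natCast_add_mul_inj {p m : ℕ} [NeZero p] {i j : ZMod p} {a b : ℕ} :
    (((i.val + p * a : ℕ)) : ZMod (p * m)) = ((j.val + p * b : ℕ) : ZMod (p * m)) ↔
      i = j ∧ a ≡ b [MOD m] := by
  rw [ZMod.natCast_eq_natCast_iff]
  constructor
  · intro h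
    have hij : i = j := by
      have := (ZMod.natCast_eq_natCast_iff _ _ p).2 (h.of_mul_right m)
      simpa using this
    subst hij
    exact ⟨rfl, Nat.ModEq.mul_left_cancel' (NeZero.ne p) (Nat.ModEq.add_left_cancel' _ h)⟩
  · rintro ⟨rfl, h⟩
    exact (h.mul_left' p).add_left _

theorem periodicFun_injective (q : Perm (ZMod p) × (ZMod p → Fin m) × ℕ)
    (hc : q.2.2.Coprime m) : Function.Injective (periodicFun p m q) := by
  intro x y h
  rw [← ZMod.natCast_zmod_val x, ← ZMod.natCast_zmod_val y] at h ⊢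
  generalize x.val = a at h ⊢
  generalize y.val = b at h ⊢
  rw [periodicFun_natCast, periodicFun_natCast, add_assoc, add_assoc, ← mul_add, ← mul_add,
    natCast_add_mul_inj] at h
  obtain ⟨h1, h2⟩ := h
  have h3 : (a : ZMod p) = b := q.1.injective h1
  rw [h3] at h2
  have h4 := Nat.ModEq.cancel_left_of_coprime hc.symm (Nat.ModEq.add_left_cancel' _ h2)
  rw [ZMod.natCast_eq_natCast_iff] at h3 ⊢
  rw [← Nat.div_add_mod a p, ← Nat.div_add_mod b p, h3]
  exact (h4.mul_left' p).add_right _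

theorem periodicFun_inj_params {q r : Perm (ZMod p) × (ZMod p → Fin m) × ℕ}
    (hq : q.2.2 ∈ Finset.Icc 1 m) (hr : r.2.2 ∈ Finset.Icc 1 m)
    (h : periodicFun p m q = periodicFun p m r) : q = r := by
  have key : ∀ i : ZMod p, q.1 i = r.1 i ∧ q.2.1 i = r.2.1 i := by
    intro i
    have h1 := congrFun h (i.val : ZMod (p * m))
    rw [periodicFun_natCast, periodicFun_natCast, Nat.div_eq_of_lt (ZMod.val_lt i)] at h1
    simp only [mul_zero, add_zero, ZMod.natCast_zmod_val] at h1
    obtain ⟨h2, h3⟩ := natCast_add_mul_inj.1 h1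
    exact ⟨h2, Fin.ext (Nat.ModEq.eq_of_lt_of_lt h3 (Fin.is_lt _) (Fin.is_lt _))⟩
  have hc : q.2.2 = r.2.2 := by
    have h1 := periodicFun_add q 0
    rw [h, periodicFun_add, add_right_inj] at h1
    have h2 : ((((0 : ZMod p)).val + p * r.2.2 : ℕ) : ZMod (p * m)) =
        (((0 : ZMod p).val + p * q.2.2 : ℕ) : ZMod (p * m)) := by
      push_cast
      simpa using h1
    have h3 := (natCast_add_mul_inj.1 h2).2
    rw [Finset.mem_Icc] at hq hr
    have h4 : r.2.2 - 1 ≡ q.2.2 - 1 [MOD m] := by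
      refine Nat.ModEq.add_right_cancel' 1 ?_
      rwa [Nat.sub_add_cancel hq.1, Nat.sub_add_cancel hr.1]
    have := Nat.ModEq.eq_of_lt_of_lt h4 (by omega) (by omega)
    omega
  exact Prod.ext (Equiv.ext fun i => (key i).1) (Prod.ext (funext fun i => (key i).2) hc)

theorem exists_periodicFun_eq (h : ∀ k, π (k + p + 1) - π (k + p) = π (k + 1) - π k) :
    ∃ q : Perm (ZMod p) × (ZMod p → Fin m) × ℕ, q.2.2 ∈ Finset.Icc 1 m ∧ q.2.2.Coprime m ∧
      (π : ZMod (p * m) → ZMod (p * m)) = periodicFun p m q := by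
  have hp : 0 < p := Nat.pos_of_ne_zero (NeZero.ne p)
  have hm : 0 < m := Nat.pos_of_ne_zero (NeZero.ne m)
  set d : ZMod (p * m) := π p - π 0 with hd
  have h1 : ∀ k, π (k + p) = π k + d := by
    intro k
    rw [← ZMod.natCast_zmod_val k]
    generalize k.val = a
    induction a with
    | zero => simp [hd]
    | succ a ih =>
      have := h (a : ZMod (p * m))
      rw [ih, show (a : ZMod (p * m)) + p + 1 = ((a + 1 : ℕ) : ZMod (p * m)) + p by
        push_cast; ring, show (a : ZMod (p * m)) + 1 = ((a + 1 : ℕ) : ZMod (p * m)) by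
        push_cast; ring] at this
      linear_combination this
  have hmd : d * m = 0 := by
    have := map_add_mul_natCast h1 0 m
    rw [natCast_mul_eq_zero, add_zero] at this
    simpa using this.symm
  obtain ⟨c, hcmem, hcd⟩ : ∃ c ∈ Finset.Icc 1 m, d = p * c := by
    have h2 : p * m ∣ d.val * m := by
      rw [← ZMod.natCast_eq_zero_iff]
      push_cast
      simpa using hmd
    obtain ⟨c, hc⟩ := Nat.dvd_of_mul_dvd_mul_right hm h2
    have hcd : d = p * c := by
      rw [← Nat.cast_mul, ← hc]
      simp
    have hclt : c < m := by
      have := ZMod.val_lt d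
      rw [hc] at this
      exact Nat.lt_of_mul_lt_mul_left this
    rcases Nat.eq_zero_or_pos c with rfl | hpos
    · refine ⟨m, Finset.mem_Icc.2 ⟨hm, le_rfl⟩, ?_⟩
      rw [natCast_mul_eq_zero, hcd]
      simp
    · exact ⟨c, Finset.mem_Icc.2 ⟨hpos, hclt.le⟩, hcd⟩
  rw [hcd] at h1
  have hcop : c.Coprime m := by
    obtain ⟨r, hr⟩ := Nat.gcd_dvd_right c m
    obtain ⟨s, hs⟩ := Nat.gcd_dvd_left c m
    have h2 := map_add_mul_natCast h1 0 r
    have h3 : (p : ZMod (p * m)) * c * r = 0 := by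
      have : p * c * r = p * m * s := by
        conv_lhs => rw [hs]
        conv_rhs => rw [hr]
        ring
      exact_mod_cast congrArg (Nat.cast : ℕ → ZMod (p * m)) this |>.trans (by
        rw [Nat.cast_mul, ZMod.natCast_self, zero_mul])
    rw [h3, add_zero] at h2
    have h4 := π.injective h2
    rw [zero_add, ← Nat.cast_mul, ZMod.natCast_eq_zero_iff] at h4
    have h5 := Nat.dvd_of_mul_dvd_mul_left hp h4
    have hrpos : 0 < r := Nat.pos_of_ne_zero fun h => by simp [h] at hr; omega
    have h6 := Nat.le_of_dvd hrpos h5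
    rw [Nat.Coprime]
    have hg : 0 < c.gcd m := Nat.gcd_pos_of_pos_right _ hm
    nlinarith
  have hred : ∀ k, redMod p m (π k) = redMod p m (π ((redMod p m k).val : ZMod (p * m))) := by
    intro k
    obtain ⟨w, hw⟩ := exists_eq_add_of_redMod_eq (x := ((redMod p m k).val : ZMod (p * m)))
      (y := k) (by simp)
    conv_lhs => rw [hw, map_add_mul_natCast h1]
    simp
  have hsurj : Function.Surjective
      fun i : ZMod p => redMod p m (π (i.val : ZMod (p * m))) := by
    intro y
    refine ⟨redMod p m (π⁻¹ (y.val : ZMod (p * m))), ?_⟩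
    dsimp only
    rw [← hred]
    simp
  let σ : Perm (ZMod p) := Equiv.ofBijective _ (Finite.surjective_iff_bijective.1 hsurj)
  let t : ZMod p → Fin m := fun i =>
    ⟨(π (i.val : ZMod (p * m))).val / p, Nat.div_lt_of_lt_mul (ZMod.val_lt _)⟩
  refine ⟨(σ, t, c), hcmem, hcop, funext fun k => ?_⟩
  rw [← ZMod.natCast_zmod_val k]
  generalize k.val = a
  rw [periodicFun_natCast]
  have ha : π (a : ZMod (p * m)) = π ((a % p : ℕ) : ZMod (p * m)) + p * c * (a / p : ℕ) := by
    rw [← map_add_mul_natCast h1, ← Nat.cast_mul, ← Nat.cast_add, Nat.mod_add_div]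
  have hv : ((a : ZMod p)).val = a % p := ZMod.val_natCast _ _
  have hσv : (σ (a : ZMod p)).val = (π ((a % p : ℕ) : ZMod (p * m))).val % p := by
    change (redMod p m (π (((a : ZMod p)).val : ZMod (p * m)))).val = _
    rw [hv, redMod_eq_natCast_val, ZMod.val_natCast]
  have htv : (t (a : ZMod p)).val = (π ((a % p : ℕ) : ZMod (p * m))).val / p := by
    change (π (((a : ZMod p)).val : ZMod (p * m))).val / p = _
    rw [hv]
  dsimp only
  rw [hσv, htv, Nat.mod_add_div, ha]
  push_cast
  rw [ZMod.natCast_zmod_val]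
  ring

/-- The number of permutations with full-cycle `predSucc` whose difference sequence is
invariant under a shift by `p`. -/
theorem ncard_periodic_predSucc_cycle (hp : Odd p) :
    {π : Perm (ZMod (p * m)) | predSucc π ∈ cyclesOn (Finset.univ : Finset (ZMod (p * m))) ∧
      ∀ k, π (k + p + 1) - π (k + p) = π (k + 1) - π k}.ncard =
      2 * p.factorial / (p + 1) * m ^ p * psi m := by
  set X := {π : Perm (ZMod (p * m)) |
    predSucc π ∈ cyclesOn (Finset.univ : Finset (ZMod (p * m))) ∧
      ∀ k, π (k + p + 1) - π (k + p) = π (k + 1) - π k} with hX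
  let A : Finset (Perm (ZMod p)) :=
    Finset.univ.filter fun σ => predSucc σ ∈ cyclesOn (Finset.univ : Finset (ZMod p))
  let P := A ×ˢ (Finset.univ : Finset (ZMod p → Fin m)) ×ˢ
    ((Finset.Icc 1 m).filter fun c => Nat.gcd c m = 1 ∧ Nat.gcd (c - 1) m = 1)
  have hA : A.card = 2 * p.factorial / (p + 1) := by
    have := card_commutator_cycle (α := ZMod p) (by rwa [ZMod.card])
      (addRight_one_mem_cyclesOn p)
    rw [ZMod.card] at this
    exact (Nat.div_eq_of_eq_mul_right (Nat.succ_pos p) this.symm).symm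
  have himg : (fun π : Perm (ZMod (p * m)) => (π : ZMod (p * m) → ZMod (p * m))) '' X =
      ((P.image (periodicFun p m) : Finset _) : Set (ZMod (p * m) → ZMod (p * m))) := by
    ext f
    simp only [Set.mem_image, Finset.coe_image, Finset.mem_coe]
    constructor
    · rintro ⟨π, ⟨h1, h2⟩, rfl⟩
      obtain ⟨q, hq1, hq2, hq3⟩ := exists_periodicFun_eq h2
      have := (predSucc_mem_cyclesOn_iff (π := π) (σ := q.1) (c := q.2.2)
        (fun k => by rw [hq3, periodicFun_add]) hq2 (Finset.mem_Icc.1 hq1).1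
        (fun k => by rw [hq3, redMod_periodicFun])).1 h1
      refine ⟨q, ?_, hq3.symm⟩
      simp only [P, A, Finset.mem_product, Finset.mem_filter, Finset.mem_univ, true_and]
      exact ⟨this.1, hq1, hq2, this.2⟩
    · rintro ⟨q, hq, rfl⟩
      simp only [P, A, Finset.mem_product, Finset.mem_filter, Finset.mem_univ, true_and] at hq
      obtain ⟨h1, h2, h3, h4⟩ := hq
      let π : Perm (ZMod (p * m)) := Equiv.ofBijective _
        (Finite.injective_iff_bijective.1 (periodicFun_injective q h3))
      have hπ : ∀ k, π (k + p) = π k + p * q.2.2 := periodicFun_add q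
      refine ⟨π, ⟨?_, fun k => ?_⟩, rfl⟩
      · exact (predSucc_mem_cyclesOn_iff hπ h3 (Finset.mem_Icc.1 h2).1
          (redMod_periodicFun q)).2 ⟨h1, h4⟩
      · rw [add_right_comm, hπ, hπ]
        ring
  rw [← Set.ncard_image_of_injective X (DFunLike.coe_injective (F := Perm (ZMod (p * m)))), himg,
    Set.ncard_coe_finset, Finset.card_image_of_injOn]
  · rw [Finset.card_product, Finset.card_product, hA, Finset.card_univ, Fintype.card_fun,
      Fintype.card_fin, ZMod.card, psi]
    ring
  · intro q hq r hr h
    simp only [P, Finset.coe_product, Set.mem_prod, Finset.mem_coe, Finset.mem_filter] at hq hr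
    exact periodicFun_inj_params hq.2.2.1 hr.2.2.1 h

end Periodic

section StrategicPile

/-- A nonempty set closed under an injective self-map of a finite type on which some point
reaches everything is everything. -/
theorem eq_univ_of_mapsTo {α : Type*} [Finite α] {f : α → α} (hf : Function.Injective f) {a : α}
    (ha : ∀ y, ∃ k, f^[k] a = y) {U : Set α} (hU : U.Nonempty) (hcl : ∀ x ∈ U, f x ∈ U) :
    U = Set.univ := by
  have himg : f '' U = U := by
    refine Set.eq_of_subset_of_ncard_le ?_ (Set.ncard_image_of_injective U hf).ge
    rintro _ ⟨x, hx, rfl⟩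
    exact hcl x hx
  have hback : ∀ k x, f^[k] x ∈ U → x ∈ U := by
    intro k
    induction k with
    | zero => exact fun x hx => hx
    | succ k ih =>
      intro x hx
      rw [Function.iterate_succ_apply] at hx
      have := ih _ hx
      rw [← himg] at this
      obtain ⟨z, hz, hzx⟩ := this
      exact hf hzx ▸ hz
  have hforw : ∀ k, ∀ x ∈ U, f^[k] x ∈ U := by
    intro k
    induction k with
    | zero => exact fun x hx => hx
    | succ k ih => exact fun x hx => by rw [Function.iterate_succ_apply]; exact ih _ (hcl x hx)
  obtain ⟨y, hy⟩ := hU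
  obtain ⟨k, rfl⟩ := ha y
  refine Set.eq_univ_of_forall fun x => ?_
  obtain ⟨l, rfl⟩ := ha x
  exact hforw l a (hback k a hy)

/-- The points strictly between `a` and the first return to `b` along the orbit of `a` are all
the points other than `a, b` exactly when the map is one cycle sending `b` to `a`. -/
theorem ncard_between_eq_iff {α : Type*} [Finite α] {f : α → α} (hf : Function.Injective f)
    {a b : α} (hab : a ≠ b) (hcard : 2 < Nat.card α) :
    {x | ∃ k m : ℕ, 0 < k ∧ k < m ∧ f^[m] a = b ∧ (∀ j, 0 < j → j < m → f^[j] a ≠ b) ∧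
      f^[k] a = x}.ncard = Nat.card α - 2 ↔ f b = a ∧ ∀ y, ∃ k, f^[k] a = y := by
  set S := {x | ∃ k m : ℕ, 0 < k ∧ k < m ∧ f^[m] a = b ∧ (∀ j, 0 < j → j < m → f^[j] a ≠ b) ∧
      f^[k] a = x} with hS
  have hsub : S ⊆ ({a, b} : Set α)ᶜ := by
    rintro x ⟨k, m, hk, hkm, hm, hmin, rfl⟩
    simp only [Set.mem_compl_iff, Set.mem_insert_iff, Set.mem_singleton_iff, not_or]
    refine ⟨fun h => hmin (m - k) (by omega) (by omega) ?_, hmin k hk hkm⟩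
    conv_lhs => rw [← h]
    rw [← Function.iterate_add_apply, Nat.sub_add_cancel hkm.le, hm]
  have hcompl : ({a, b} : Set α)ᶜ.ncard = Nat.card α - 2 := by
    rw [Set.ncard_compl, Set.ncard_pair hab]
  constructor
  · intro h
    have hSeq : S = ({a, b} : Set α)ᶜ :=
      Set.eq_of_subset_of_ncard_le hsub (by rw [hcompl, h])
    have hne : S.Nonempty := by
      rw [← Set.ncard_pos, h]
      omega
    obtain ⟨_, k₀, m, hk, hkm, hm, hmin, -⟩ := hne
    constructor
    · by_contra hba
      by_cases hbb : f b = b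
      · refine hmin (m - 1) (by omega) (by omega) (hf ?_)
        rw [← Function.iterate_succ_apply' f, Nat.succ_eq_add_one, Nat.sub_add_cancel (by omega),
          hm, hbb]
      · have : f b ∈ S := by
          rw [hSeq]
          simp [hba, hbb]
        obtain ⟨k, m, hk, hkm, hm, hmin, hkb⟩ := this
        have hk1 : f^[k - 1] a = b := by
          apply hf
          rw [← Function.iterate_succ_apply' f, Nat.succ_eq_add_one, Nat.sub_add_cancel (by omega),
            hkb]
        rcases Nat.eq_zero_or_pos (k - 1) with h0 | h0
        · rw [h0] at hk1
          exact hab hk1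
        · exact hmin _ h0 (by omega) hk1
    · intro y
      by_cases hya : y = a
      · exact ⟨0, hya.symm⟩
      by_cases hyb : y = b
      · exact ⟨m, by rw [hm, hyb]⟩
      have : y ∈ S := by
        rw [hSeq]
        simp [hya, hyb]
      obtain ⟨k, _, _, _, _, _, h⟩ := this
      exact ⟨k, h⟩
  · rintro ⟨hba, hy⟩
    rw [← hcompl]
    congr 1
    refine hsub.antisymm fun x hx => ?_
    simp only [Set.mem_compl_iff, Set.mem_insert_iff, Set.mem_singleton_iff, not_or] at hx
    classical
    have hb := hy b
    have hx' := hy x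
    refine ⟨Nat.find hx', Nat.find hb, ?_, ?_, Nat.find_spec hb, fun j _ hj => Nat.find_min hb hj,
      Nat.find_spec hx'⟩
    · rw [Nat.find_pos]
      exact fun h => hx.1 h.symm
    · by_contra! hle
      have hlt : Nat.find hb < Nat.find hx' := by
        refine lt_of_le_of_ne hle fun h => hx.2 ?_
        rw [← Nat.find_spec hx', ← h, Nat.find_spec hb]
      refine Nat.find_min hx' (m := Nat.find hx' - (Nat.find hb + 1)) (by omega) ?_
      conv_rhs => rw [← Nat.find_spec hx']
      have e : Nat.find hx' = (Nat.find hx' - (Nat.find hb + 1)) + (Nat.find hb + 1) := by omega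
      conv_rhs => rw [e, Function.iterate_add_apply, Function.iterate_succ_apply',
        Nat.find_spec hb, hba]

/-- If `D` is obtained from `f` by cutting the points `b` and `a = f b` out of the cycles of
`f`, then one is a full cycle if and only if the other is. -/
theorem forall_iterate_iff_of_bypass {α β : Type*} [Finite α] [Finite β] {f : α → α}
    (hf : Function.Injective f) {a b : α} (hab : a ≠ b) (hba : f b = a) (hfa : f a ≠ b)
    {j : β → α} (hj : Function.Injective j) (hja : ∀ x, j x ≠ a) (hjb : ∀ x, j x ≠ b)
    (hsurj : ∀ y, y ≠ a → y ≠ b → ∃ x, j x = y) {D : Perm β}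
    (hD : ∀ x, f (j x) = j (D x) ∨ f (j x) = b ∧ f a = j (D x)) :
    (∀ y, ∃ k, f^[k] a = y) ↔ ∀ x y : β, ∃ k : ℕ, (D ^ k) x = y := by
  constructor
  · intro h x y
    set T : Set β := {y | ∃ k : ℕ, (D ^ k) x = y} with hT
    have hTD : ∀ z ∈ T, D z ∈ T := by
      rintro _ ⟨k, rfl⟩
      exact ⟨k + 1, by rw [pow_succ', Perm.mul_apply]⟩
    have hxT : x ∈ T := ⟨0, rfl⟩
    have hU : {z | (∃ t ∈ T, j t = z) ∨ (z = a ∨ z = b) ∧ ∃ t ∈ T, f (j t) = b} = Set.univ := by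
      refine eq_univ_of_mapsTo hf h ⟨j x, Or.inl ⟨x, hxT, rfl⟩⟩ ?_
      rintro z (⟨t, ht, rfl⟩ | ⟨rfl | rfl, t, ht, htb⟩)
      · rcases hD t with h1 | ⟨h1, h2⟩
        · exact Or.inl ⟨D t, hTD t ht, h1.symm⟩
        · exact Or.inr ⟨Or.inr h1, t, ht, h1⟩
      · rcases hD t with h1 | ⟨h1, h2⟩
        · exact absurd (h1.symm.trans htb) (hjb _)
        · exact Or.inl ⟨D t, hTD t ht, h2.symm⟩
      · exact Or.inr ⟨Or.inl hba, t, ht, htb⟩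
    have hy : j y ∈ (Set.univ : Set α) := Set.mem_univ _
    rw [← hU] at hy
    rcases hy with ⟨t, ht, hty⟩ | ⟨h1 | h1, -⟩
    · exact hj hty ▸ ht
    · exact absurd h1 (hja y)
    · exact absurd h1 (hjb y)
  · intro h
    have hstep : ∀ z, (∃ k, f^[k] a = z) → ∃ k, f^[k] a = f z := by
      rintro _ ⟨k, rfl⟩
      exact ⟨k + 1, Function.iterate_succ_apply' f k a⟩
    obtain ⟨z, hz⟩ := hsurj (f a) (fun h' => hab (hf (h'.trans hba.symm))) hfa
    have hjz : ∀ k : ℕ, ∃ l, f^[l] a = j ((D ^ k) z) := by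
      intro k
      induction k with
      | zero => exact ⟨1, hz.symm⟩
      | succ k ih =>
        rw [pow_succ', Perm.mul_apply]
        rcases hD ((D ^ k) z) with h1 | ⟨-, h2⟩
        · rw [← h1]
          exact hstep _ ih
        · exact ⟨1, h2⟩
    have hall : ∀ x, ∃ l, f^[l] a = j x := by
      intro x
      obtain ⟨k, rfl⟩ := h z x
      exact hjz k
    intro y
    by_cases hya : y = a
    · exact ⟨0, hya.symm⟩
    by_cases hyb : y = b
    · subst hyb
      obtain ⟨w, hw⟩ := Finite.surjective_of_injective hf y
      rw [← hw]
      apply hstep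
      by_cases hwa : w = a
      · exact ⟨0, hwa.symm⟩
      by_cases hwy : w = y
      · exact absurd (hba.symm.trans (hwy ▸ hw)) hab
      obtain ⟨x, rfl⟩ := hsurj w hwa hwy
      exact hall x
    · obtain ⟨x, rfl⟩ := hsurj y hya hyb
      exact hall x

theorem repr1_pos {n : ℕ} [NeZero n] (x : ZMod n) : 1 ≤ repr1 n x := by
  rw [repr1]
  split_ifs with h
  · exact NeZero.one_le
  · exact Nat.one_le_iff_ne_zero.2 ((ZMod.val_ne_zero x).2 h)

theorem repr1_le {n : ℕ} [NeZero n] (x : ZMod n) : repr1 n x ≤ n := by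
  rw [repr1]
  split_ifs
  · exact le_rfl
  · exact (ZMod.val_lt x).le

theorem natCast_repr1 {n : ℕ} [NeZero n] (x : ZMod n) : (repr1 n x : ZMod n) = x := by
  rw [repr1]
  split_ifs with h
  · simp [h]
  · simp

theorem repr1_natCast {n k : ℕ} (h1 : 1 ≤ k) (h2 : k ≤ n) : repr1 n (k : ZMod n) = k := by
  rw [repr1]
  rcases h2.eq_or_lt with rfl | h
  · simp
  · rw [if_neg, ZMod.val_cast_of_lt h]
    rw [ZMod.natCast_eq_zero_iff]
    exact Nat.not_dvd_of_pos_of_lt h1 h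

theorem natCast_inj_of_lt {n a b : ℕ} (ha : a < n) (hb : b < n)
    (h : (a : ZMod n) = (b : ZMod n)) : a = b := by
  rw [ZMod.natCast_eq_natCast_iff'] at h
  rwa [Nat.mod_eq_of_lt ha, Nat.mod_eq_of_lt hb] at h

theorem natCast_inj_of_le {n a b : ℕ} (ha : 1 ≤ a) (ha' : a ≤ n) (hb : 1 ≤ b) (hb' : b ≤ n)
    (h : (a : ZMod n) = (b : ZMod n)) : a = b := by
  rw [← repr1_natCast ha ha', h, repr1_natCast hb hb']

theorem emb_ne_zero {n : ℕ} [NeZero n] (x : ZMod n) : emb n x ≠ 0 := by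
  intro h
  have := repr1_pos x
  have h' := natCast_inj_of_lt (n := n + 1) (Nat.lt_succ_of_le (repr1_le x)) (Nat.succ_pos n)
    (by rw [Nat.cast_zero]; exact h)
  omega

theorem emb_natCast {n k : ℕ} (h1 : 1 ≤ k) (h2 : k ≤ n) :
    emb n (k : ZMod n) = (k : ZMod (n + 1)) := by
  rw [emb, repr1_natCast h1 h2]

theorem natCast_val_emb {n : ℕ} [NeZero n] (x : ZMod n) : ((emb n x).val : ZMod n) = x := by
  rw [emb, ZMod.val_cast_of_lt (Nat.lt_succ_of_le (repr1_le x)), natCast_repr1]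

theorem emb_natCast_val {n : ℕ} {y : ZMod (n + 1)} (hy : y ≠ 0) :
    emb n (y.val : ZMod n) = y := by
  rw [emb_natCast (Nat.one_le_iff_ne_zero.2 ((ZMod.val_ne_zero y).2 hy))
    (Nat.lt_succ_iff.1 (ZMod.val_lt y)), ZMod.natCast_zmod_val]

theorem natCast_self_eq_neg_one (n : ℕ) : (n : ZMod (n + 1)) = -1 := by
  rw [eq_neg_iff_add_eq_zero]
  exact_mod_cast ZMod.natCast_self (n + 1)

theorem listFun_natCast {n : ℕ} (π : Perm (ZMod n)) {k : ℕ} (h1 : 1 ≤ k)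
    (h2 : k ≤ n) :
    listFun n π (k : ZMod (n + 1)) = emb n (π k) := by
  have hv : (k : ZMod (n + 1)).val = k := ZMod.val_cast_of_lt (Nat.lt_succ_of_le h2)
  rw [listFun, if_neg, hv]
  intro h
  rw [h, ZMod.val_zero] at hv
  omega

variable {n : ℕ} [NeZero n] (π : Perm (ZMod n))

theorem listInv_listFun (i : ZMod (n + 1)) : listInv n π (listFun n π i) = i := by
  by_cases h : i = 0
  · simp [h, listFun, listInv]
  · rw [listFun, if_neg h, listInv, if_neg (emb_ne_zero _), natCast_val_emb, Equiv.symm_apply_apply,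
      emb_natCast_val h]

theorem listFun_surjective : Function.Surjective (listFun n π) :=
  Finite.surjective_of_injective (Function.LeftInverse.injective (listInv_listFun π))

theorem Cfun_listFun_sub_one (i : ZMod (n + 1)) :
    Cfun n π (listFun n π i - 1) = listFun n π (i - 1) := by
  rw [Cfun, sub_add_cancel, Yfun, listInv_listFun]

theorem Cfun_injective : Function.Injective (Cfun n π) := by
  intro x y h
  obtain ⟨i, hi⟩ := listFun_surjective π (x + 1)
  obtain ⟨k, hk⟩ := listFun_surjective π (y + 1)
  obtain rfl : x = listFun n π i - 1 := by rw [hi, add_sub_cancel_right]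
  obtain rfl : y = listFun n π k - 1 := by rw [hk, add_sub_cancel_right]
  rw [Cfun_listFun_sub_one, Cfun_listFun_sub_one] at h
  rw [sub_left_injective (Function.LeftInverse.injective (listInv_listFun π) h)]

theorem Cfun_natCast_self : Cfun n π (n : ZMod (n + 1)) = listFun n π n := by
  have := Cfun_listFun_sub_one π 0
  rwa [show listFun n π 0 = 0 from if_pos rfl, zero_sub, ← natCast_self_eq_neg_one] at this

theorem maxPile_iff (hn : Even n) :
    MaxPile n π ↔ Cfun n π 0 = n ∧ ∀ y, ∃ k, (Cfun n π)^[k] (n : ZMod (n + 1)) = y := by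
  have h2 : 2 ≤ n := by
    obtain ⟨r, rfl⟩ := hn
    have := NeZero.ne (r + r)
    omega
  have hne : (n : ZMod (n + 1)) ≠ 0 := by
    have : Nontrivial (ZMod (n + 1)) := ZMod.nontrivial_iff.2 (by omega)
    rw [natCast_self_eq_neg_one]
    exact neg_ne_zero.2 one_ne_zero
  have hcard : Nat.card (ZMod (n + 1)) = n + 1 := by rw [Nat.card_eq_fintype_card, ZMod.card]
  rw [← ncard_between_eq_iff (Cfun_injective π) hne (by rw [hcard]; omega), hcard, MaxPile]
  simp only [hn, true_and, Nat.not_odd_iff_even.2 hn, false_and, or_false]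
  rfl

theorem natCast_repr1_add_one {N : ℕ} [NeZero N] {x : ZMod N} (hx : x ≠ 0) :
    repr1 N (x + 1) = repr1 N x + 1 := by
  have h : repr1 N x < N := by
    rw [repr1, if_neg hx]
    exact ZMod.val_lt x
  conv_lhs => rw [← natCast_repr1 x]
  exact_mod_cast repr1_natCast (Nat.succ_pos _) h

/-- Deleting the largest entry `N + 1`, which immediately precedes `1`, turns the cycle
structure of `Cfun` into that of `predSucc`. -/
theorem forall_iterate_Cfun_iff {N m : ℕ} [NeZero N] {ρ : Perm (ZMod N)}
    {π : Perm (ZMod (N + 1))} (hC : Cfun (N + 1) π 0 = (N + 1 : ℕ)) (h1 : 1 ≤ m) (h2 : m ≤ N + 1)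
    (hm : π m = ((N + 1 : ℕ) : ZMod (N + 1)))
    (hlt : ∀ k : ℕ, 1 ≤ k → k < m → ρ k = (repr1 (N + 1) (π k) : ZMod N))
    (hge : ∀ k : ℕ, m ≤ k → k ≤ N → ρ k = (repr1 (N + 1) (π (k + 1 : ℕ)) : ZMod N)) :
    (∀ y, ∃ k, (Cfun (N + 1) π)^[k] ((N + 1 : ℕ) : ZMod (N + 1 + 1)) = y) ↔
      ∀ x y : ZMod N, ∃ k : ℕ, (predSucc ρ ^ k) x = y := by
  have hN : 1 ≤ N := NeZero.one_le
  set j : ZMod N → ZMod (N + 1 + 1) := fun x => (repr1 N x : ZMod (N + 1 + 1)) with hj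
  have hjcast : ∀ c : ℕ, 1 ≤ c → c ≤ N → j (c : ZMod N) = (c : ZMod (N + 1 + 1)) :=
    fun c h h' => by rw [hj]; simp only [repr1_natCast h h']
  have hjinj : Function.Injective j := fun x y h => by
    have hx := repr1_le x
    have hy := repr1_le y
    rw [← natCast_repr1 x, natCast_inj_of_lt (n := N + 1 + 1) (by omega) (by omega) h,
      natCast_repr1]
  have hj0 : ∀ x, j x ≠ 0 := fun x h => by
    have hx := repr1_le x
    have hx' := repr1_pos x
    have := natCast_inj_of_lt (n := N + 1 + 1) (b := 0) (by omega) (by omega)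
      (h.trans Nat.cast_zero.symm)
    omega
  have hjK : ∀ x, j x ≠ (N + 1 : ℕ) := fun x h => by
    have hx := repr1_le x
    have := natCast_inj_of_lt (n := N + 1 + 1) (by omega) (by omega) h
    omega
  have hL0 : listFun (N + 1) π 0 = 0 := if_pos rfl
  have hLinj : Function.Injective (listFun (N + 1) π) :=
    Function.LeftInverse.injective (listInv_listFun π)
  have hLm : listFun (N + 1) π m = (N + 1 : ℕ) := by
    rw [listFun_natCast π h1 h2, hm, emb_natCast (by omega) le_rfl]
  obtain ⟨i, hi⟩ := listFun_surjective π 1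
  have him : listFun (N + 1) π (i - 1) = (N + 1 : ℕ) := by
    rw [← Cfun_listFun_sub_one, hi, sub_self, hC]
  obtain rfl : i = m + 1 := by
    rw [← hLinj (him.trans hLm.symm), sub_add_cancel]
  have hmN : m ≤ N := by
    by_contra hlt
    obtain rfl : m = N + 1 := by omega
    rw [natCast_self_eq_neg_one, neg_add_cancel, hL0] at hi
    have := natCast_inj_of_lt (n := N + 1 + 1) (a := 0) (b := 1) (by omega) (by omega)
      (by simpa using hi)
    omega
  have hπne : ∀ k : ℕ, 1 ≤ k → k ≤ N + 1 → k ≠ m → repr1 (N + 1) (π k) ≤ N := by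
    intro k hk hk' hkm
    by_contra hgt
    have := repr1_le (π k)
    have h : π k = ((N + 1 : ℕ) : ZMod (N + 1)) := by
      rw [← natCast_repr1 (π k)]
      congr 1
      omega
    exact hkm (natCast_inj_of_le hk hk' h1 h2 (π.injective (h.trans hm.symm)))
  have hjlt : ∀ k : ℕ, 1 ≤ k → k < m → j (ρ k) = listFun (N + 1) π k := by
    intro k hk hkm
    rw [hlt k hk hkm, hjcast _ (repr1_pos _) (hπne k hk (by omega) hkm.ne),
      listFun_natCast π hk (by omega), emb]
  have hjge : ∀ k : ℕ, m ≤ k → k ≤ N → j (ρ k) = listFun (N + 1) π (k + 1 : ℕ) := by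
    intro k hk hkN
    rw [hge k hk hkN, hjcast _ (repr1_pos _) (hπne (k + 1) (by omega) (by omega) (by omega)),
      listFun_natCast π (by omega) (by omega), emb]
  have hρm : ρ m = 1 := by
    apply hjinj
    rw [hjge m le_rfl hmN, Nat.cast_succ, hi]
    have := hjcast 1 le_rfl hN
    simpa using this.symm
  have hCK : Cfun (N + 1) π (N + 1 : ℕ) = j (ρ 0) := by
    rw [Cfun_natCast_self, ← hjge N hmN le_rfl, ZMod.natCast_self]
  refine forall_iterate_iff_of_bypass (Cfun_injective π) ?_ hC (hCK ▸ hj0 _) hjinj hjK hj0 ?_ ?_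
  · rw [natCast_self_eq_neg_one]
    have : Nontrivial (ZMod (N + 1 + 1)) := ZMod.nontrivial_iff.2 (by omega)
    exact neg_ne_zero.2 one_ne_zero
  · intro y hyK hy0
    have hv := ZMod.val_lt y
    have hv0 := (ZMod.val_ne_zero y).2 hy0
    have hvK : y.val ≠ N + 1 := fun h =>
      hyK ((ZMod.natCast_zmod_val y).symm.trans (congrArg _ h))
    exact ⟨y.val, by rw [hjcast _ (by omega) (by omega), ZMod.natCast_zmod_val]⟩
  · intro x
    obtain ⟨i, hi1, hiN, hix⟩ : ∃ i : ℕ, 1 ≤ i ∧ i ≤ N ∧ ρ i = x + 1 :=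
      ⟨repr1 N (ρ.symm (x + 1)), repr1_pos _, repr1_le _, by
        rw [natCast_repr1, Equiv.apply_symm_apply]⟩
    have hDx : predSucc ρ x = ρ ((i - 1 : ℕ) : ZMod N) := by
      rw [Nat.cast_pred hi1, ← predSucc_apply_sub_one, hix, add_sub_cancel_right]
    rw [hDx, hCK]
    by_cases hx0 : x = 0
    · obtain rfl : i = m := by
        refine natCast_inj_of_le hi1 hiN h1 hmN (ρ.injective ?_)
        rw [hix, hρm, hx0, zero_add]
      have hjx : j x = listFun (N + 1) π i - 1 := by
        rw [hLm, hx0, ← ZMod.natCast_self, hjcast N hN le_rfl]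
        simp
      rw [hjx, Cfun_listFun_sub_one, ← Nat.cast_pred hi1]
      rcases hi1.eq_or_lt with rfl | hlt1
      · right
        simpa using hL0
      · left
        rw [hjlt (i - 1) (by omega) (by omega)]
    · have hjx : ∀ l, j (ρ i) = listFun (N + 1) π l → j x = listFun (N + 1) π l - 1 := by
        intro l hl
        rw [← hl, hix, hj]
        simp [natCast_repr1_add_one hx0]
      have him : i ≠ m := by
        rintro rfl
        rw [hρm] at hix
        exact hx0 (by simpa using hix.symm)
      rcases lt_or_gt_of_ne him with h | h
      · rw [hjx _ (hjlt i hi1 h), Cfun_listFun_sub_one, ← Nat.cast_pred hi1]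
        rcases hi1.eq_or_lt with rfl | hlt1
        · right
          simpa using hL0
        · left
          rw [hjlt (i - 1) (by omega) (by omega)]
      · left
        rw [hjx _ (hjge i h.le hiN), Cfun_listFun_sub_one, hjge (i - 1) (by omega) (by omega),
          Nat.sub_add_cancel hi1]
        simp

/-- Every permutation is obtained by deleting the largest entry from a permutation in which the
largest entry immediately precedes `1`. -/
theorem exists_insert_before_one {N : ℕ} [NeZero N] (ρ : Perm (ZMod N)) :
    ∃ π : Perm (ZMod (N + 1)), Cfun (N + 1) π 0 = (N + 1 : ℕ) ∧ ∃ m : ℕ, 1 ≤ m ∧ m ≤ N + 1 ∧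
      π m = ((N + 1 : ℕ) : ZMod (N + 1)) ∧
      (∀ k : ℕ, 1 ≤ k → k < m → ρ k = (repr1 (N + 1) (π k) : ZMod N)) ∧
      ∀ k : ℕ, m ≤ k → k ≤ N → ρ k = (repr1 (N + 1) (π (k + 1 : ℕ)) : ZMod N) := by
  have hN : 1 ≤ N := NeZero.one_le
  obtain ⟨m, hm1, hmN, hm⟩ : ∃ m : ℕ, 1 ≤ m ∧ m ≤ N ∧ ρ m = 1 :=
    ⟨repr1 N (ρ.symm 1), repr1_pos _, repr1_le _, by rw [natCast_repr1, Equiv.apply_symm_apply]⟩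
  let e : ℕ → ℕ := fun k => if k < m then k else k - 1
  let f : ZMod (N + 1) → ZMod (N + 1) := fun x =>
    if repr1 (N + 1) x = m then 0 else (repr1 N (ρ (e (repr1 (N + 1) x))) : ZMod (N + 1))
  have hf0 : ∀ y : ZMod N, (repr1 N y : ZMod (N + 1)) ≠ 0 := fun y => emb_ne_zero y
  have hfinj : Function.Injective f := by
    intro x y h
    have hx1 := repr1_pos x
    have hx2 := repr1_le x
    have hy1 := repr1_pos y
    have hy2 := repr1_le y
    have hxy : repr1 (N + 1) x = repr1 (N + 1) y := by
      simp only [f] at h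
      split_ifs at h with h1 h2 h2
      · rw [h1, h2]
      · exact absurd h.symm (hf0 _)
      · exact absurd h (hf0 _)
      · have h3 := natCast_inj_of_lt (Nat.lt_succ_of_le (repr1_le _))
          (Nat.lt_succ_of_le (repr1_le _)) h
        have h4 : ρ (e (repr1 (N + 1) x)) = ρ (e (repr1 (N + 1) y)) := by
          rw [← natCast_repr1 (ρ (e (repr1 (N + 1) x))), h3, natCast_repr1]
        have h5 := natCast_inj_of_le (n := N) (by grind) (by grind) (by grind) (by grind)
          (ρ.injective h4)
        grind
    rw [← natCast_repr1 x, hxy, natCast_repr1]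
  let π : Perm (ZMod (N + 1)) :=
    Equiv.ofBijective f (Finite.injective_iff_bijective.1 hfinj)
  have hπ : ∀ x, π x = f x := fun _ => rfl
  have hπm : π m = ((N + 1 : ℕ) : ZMod (N + 1)) := by
    rw [hπ, ZMod.natCast_self]
    simp only [f, repr1_natCast hm1 (by omega : m ≤ N + 1), if_true]
  have hπk : ∀ k : ℕ, 1 ≤ k → k ≤ N + 1 → k ≠ m → π k = (repr1 N (ρ (e k)) : ZMod (N + 1)) := by
    intro k hk hk' hkm
    rw [hπ]
    simp only [f, repr1_natCast hk hk', if_neg hkm]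
  have hrep : ∀ y : ZMod N,
      (repr1 (N + 1) ((repr1 N y : ZMod (N + 1))) : ZMod N) = y := fun y => by
    rw [repr1_natCast (repr1_pos y) ((repr1_le y).trans (Nat.le_succ N)), natCast_repr1]
  refine ⟨π, ?_, m, hm1, by omega, hπm, ?_, ?_⟩
  · have hL1 : listFun (N + 1) π (m + 1 : ℕ) = 1 := by
      rw [listFun_natCast π (by omega) (by omega), hπk (m + 1) (by omega) (by omega) (by omega)]
      have : e (m + 1) = m := by grind
      have h1 : repr1 N (1 : ZMod N) = 1 := by
        have := repr1_natCast (n := N) (k := 1) le_rfl hN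
        simpa using this
      rw [this, hm, h1, emb_natCast le_rfl (by omega), Nat.cast_one]
    have := Cfun_listFun_sub_one π (m + 1 : ℕ)
    rw [hL1, sub_self] at this
    rw [this, Nat.cast_succ, add_sub_cancel_right, listFun_natCast π hm1 (by omega), hπm,
      emb_natCast (by omega) le_rfl]
  · intro k hk hkm
    rw [hπk k hk (by omega) hkm.ne, hrep]
    congr 2
    grind
  · intro k hk hkN
    rw [hπk (k + 1) (by omega) (by omega) (by omega), hrep]
    congr 2
    grind

theorem mem_MsetAll_iff {n : ℕ} (hn : 0 < n) (ρ : Perm (ZMod (2 * n - 1))) :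
    ρ ∈ MsetAll n ↔ ∀ x y : ZMod (2 * n - 1), ∃ k : ℕ, (predSucc ρ ^ k) x = y := by
  obtain ⟨r, rfl⟩ : ∃ r, n = r + 1 := ⟨n - 1, by omega⟩
  have he : Even (2 * r + 1 + 1) := ⟨r + 1, by ring⟩
  constructor
  · rintro ⟨π, hmax, m, h1, h2, hm, hlt, hge⟩
    have := (maxPile_iff (n := 2 * r + 1 + 1) π he).1 hmax
    exact (forall_iterate_Cfun_iff (N := 2 * r + 1) this.1 h1 h2 hm hlt hge).1 this.2
  · intro h
    obtain ⟨π, hC, m, h1, h2, hm, hlt, hge⟩ := exists_insert_before_one (N := 2 * r + 1) ρ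
    exact ⟨π, (maxPile_iff (n := 2 * r + 1 + 1) π he).2
      ⟨hC, (forall_iterate_Cfun_iff (N := 2 * r + 1) hC h1 h2 hm hlt hge).2 h⟩,
      m, h1, h2, hm, hlt, hge⟩

end StrategicPile

end

/-- Let `p ∣ 2n-1`.  The number of permutations in `M_{2n}` whose
difference sequence is periodic with a period dividing `p` equals
`2·(p!/(p+1)) · ((2n-1)/p)^p · ψ((2n-1)/p)`. -/
theorem stmt12 (n p : ℕ) (hn : 0 < n) (hdvd : p ∣ 2 * n - 1) :
    {π ∈ MsetAll n | ∀ k : ZMod (2 * n - 1),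
        Dseq (2 * n - 1) π (k + (p : ZMod (2 * n - 1))) = Dseq (2 * n - 1) π k}.ncard =
      2 * Nat.factorial p / (p + 1) * ((2 * n - 1) / p) ^ p * psi ((2 * n - 1) / p) := by
  obtain ⟨m, hm⟩ := hdvd
  have hpm : 0 < p * m := by omega
  have : NeZero p := ⟨(Nat.pos_of_mul_pos_right hpm).ne'⟩
  have : NeZero m := ⟨(Nat.pos_of_mul_pos_left hpm).ne'⟩
  have hodd : Odd (p * m) := by
    rw [← hm]
    exact ⟨n - 1, by omega⟩
  have hcount : ∀ N, N = p * m → {π : Equiv.Perm (ZMod N) |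
      (∀ x y : ZMod N, ∃ k : ℕ, (predSucc π ^ k) x = y) ∧
        ∀ k : ZMod N, π (k + p + 1) - π (k + p) = π (k + 1) - π k}.ncard =
      2 * p.factorial / (p + 1) * m ^ p * psi m := by
    rintro _ rfl
    simp_rw [← mem_cyclesOn_univ_iff]
    exact ncard_periodic_predSucc_cycle (Nat.odd_mul.1 hodd).1
  rw [show (2 * n - 1) / p = m by rw [hm, Nat.mul_div_cancel_left _ (NeZero.pos p)],
    ← hcount (2 * n - 1) hm]
  congr 1
  ext π
  exact and_congr_left' (mem_MsetAll_iff hn π)
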